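/- Let M = {1^{k_1}, 2^{k_2}, ..., n^{k_n}} be a multiset with each k_i ≥ 1 and K = k_1 + k_2 + ... + k_n. Then Q_M(x,y,z) = Σ_{i=0}^{K−n} z^i Σ_{j=1}^{⌊(K+1−i)/2⌋} γ_{i,j} (xy)^j (x+y)^{K+1−i−2j}, where Q_M(x,y,z) = Σ_{π Stirling permutation of M} x^{asc(π)} y^{des(π)} z^{plat(π)} and γ_{i,j} is the number of weakly increasing trees T ∈ ℐ𝒯_M with cdes(T) = j, eleaf(T) = i and dcdes(T) = 0. In particular, Q_M(x,y,z) is partial γ-positive. -/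

import Mathlib

/-! Common definitions: words (permutations of multisets), their statistics,
ordered labeled trees and their cyclic statistics. -/

attribute [local instance] Classical.propDecidable

/-- `asc`: number of indices `0 ≤ i ≤ m` with `π_i < π_{i+1}`, convention `π_0 = π_{m+1} = 0`. -/
def ascW (w : List ℕ) : ℕ :=
  (((0 :: (w ++ [0])).zip (w ++ [0])).countP fun p => decide (p.1 < p.2))

def desW (w : List ℕ) : ℕ :=
  (((0 :: (w ++ [0])).zip (w ++ [0])).countP fun p => decide (p.2 < p.1))

def platW (w : List ℕ) : ℕ :=
  (((0 :: (w ++ [0])).zip (w ++ [0])).countP fun p => decide (p.1 = p.2))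

/-- quasi-Stirling: no indices `i < j < k < l` with `π_i = π_k` and `π_j = π_l`. -/
def IsQuasiStirling (w : List ℕ) : Prop :=
  ¬ ∃ l, l < w.length ∧ ∃ k, k < l ∧ ∃ j, j < k ∧ ∃ i, i < j ∧
      w.getD i 0 = w.getD k 0 ∧ w.getD j 0 = w.getD l 0

/-- Stirling: no indices `i < j < k` with `π_i = π_k` and `π_j < π_i`. -/
def IsStirling (w : List ℕ) : Prop :=
  ¬ ∃ k, k < w.length ∧ ∃ j, j < k ∧ ∃ i, i < j ∧
      w.getD i 0 = w.getD k 0 ∧ w.getD j 0 < w.getD i 0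

/-- The multiset `{1^{k 1}, 2^{k 2}, …, n^{k n}}`. -/
def msetM (n : ℕ) (k : ℕ → ℕ) : Multiset ℕ :=
  ∑ i ∈ Finset.Icc 1 n, Multiset.replicate (k i) i

/-- The finite set of all words whose multiset of letters is `M`. -/
noncomputable def permsOf (M : Multiset ℕ) : Finset (List ℕ) :=
  M.toList.permutations.toFinset

/-- The finite set of quasi-Stirling permutations of `M`. -/
noncomputable def qsPerms (M : Multiset ℕ) : Finset (List ℕ) :=
  (permsOf M).filter IsQuasiStirling

/-- The finite set of Stirling permutations of `M`. -/
noncomputable def sPerms (M : Multiset ℕ) : Finset (List ℕ) :=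
  (permsOf M).filter IsStirling

open MvPolynomial in
/-- `Q̄_M(x,y,z)`, with `x = X 0`, `y = X 1`, `z = X 2`. -/
noncomputable def QbarPoly (M : Multiset ℕ) : MvPolynomial (Fin 3) ℤ :=
  ∑ w ∈ qsPerms M, X 0 ^ ascW w * X 1 ^ desW w * X 2 ^ platW w

open MvPolynomial in
/-- `Q_M(x,y,z)`, with `x = X 0`, `y = X 1`, `z = X 2`. -/
noncomputable def QPoly (M : Multiset ℕ) : MvPolynomial (Fin 3) ℤ :=
  ∑ w ∈ sPerms M, X 0 ^ ascW w * X 1 ^ desW w * X 2 ^ platW w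

/-! Cyclic statistics of a word `w_0 w_1 … w_ℓ` read cyclically. -/

/-- Number of cyclic descents of a word: indices `i` with `w_i > w_{i+1}`, indices mod `ℓ+1`. -/
def cdesW (w : List ℕ) : ℕ := ((w.zip (w.rotate 1)).countP fun p => decide (p.2 < p.1))

/-- Number of cyclic ascents. -/
def cascW (w : List ℕ) : ℕ := ((w.zip (w.rotate 1)).countP fun p => decide (p.1 < p.2))

/-- The list of cyclic triples `(w_{i-1}, w_i, w_{i+1})`, indices mod `ℓ+1`. -/
def cycTriples (w : List ℕ) : List (ℕ × ℕ × ℕ) :=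
  (w.rotate (w.length - 1)).zip (w.zip (w.rotate 1))

/-- Number of double cyclic descents of a word: indices with `w_{i-1} > w_i > w_{i+1}`. -/
def dcdesW (w : List ℕ) : ℕ :=
  ((cycTriples w).countP fun p => decide (p.2.1 < p.1 ∧ p.2.2 < p.2.1))

/-- Number of double cyclic ascents of a word: indices with `w_{i-1} < w_i < w_{i+1}`. -/
def dcascW (w : List ℕ) : ℕ :=
  ((cycTriples w).countP fun p => decide (p.1 < p.2.1 ∧ p.2.1 < p.2.2))

/-- Number of cyclic peaks of a word: indices with `w_{i-1} < w_i > w_{i+1}`. -/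
def cpeakW (w : List ℕ) : ℕ :=
  ((cycTriples w).countP fun p => decide (p.1 < p.2.1 ∧ p.2.2 < p.2.1))

/-- Number of cyclic valleys of a word: indices with `w_{i-1} > w_i < w_{i+1}`. -/
def cvalW (w : List ℕ) : ℕ :=
  ((cycTriples w).countP fun p => decide (p.2.1 < p.1 ∧ p.2.1 < p.2.2))

/-- Ordered labeled trees: rooted plane trees with labels in `ℕ`. -/
inductive LTree : Type where
  | node (label : ℕ) (children : List LTree) : LTree

namespace LTree

/-- The label of the root. -/
def label : LTree → ℕ
  | node a _ => a

theorem sizeOf_lt_of_mem {s : LTree} {ts : List LTree} (h : s ∈ ts) {a : ℕ} :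
    sizeOf s < sizeOf (LTree.node a ts) := by
  have := List.sizeOf_lt_of_mem h
  simp only [node.sizeOf_spec]
  omega

/-- The multiset of all vertex labels. -/
def labels : LTree → Multiset ℕ
  | node a ts => a ::ₘ (ts.attach.map (fun s => labels s.1)).sum
decreasing_by exact sizeOf_lt_of_mem s.2

/-- The word `v_0 v_1 … v_ℓ` associated to a vertex: its label followed by the labels of
its children from left to right. -/
def wordOf : LTree → List ℕ
  | node a ts => a :: ts.map label

/-- `cdes(T) = ∑_{u ∈ V(T)} cdes(u)`. -/
def cdes : LTree → ℕ
  | node a ts => cdesW (a :: ts.map label) + (ts.attach.map (fun s => cdes s.1)).sum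
decreasing_by exact sizeOf_lt_of_mem s.2

/-- `casc(T) = ∑_{u ∈ V(T)} casc(u)`. -/
def casc : LTree → ℕ
  | node a ts => cascW (a :: ts.map label) + (ts.attach.map (fun s => casc s.1)).sum
decreasing_by exact sizeOf_lt_of_mem s.2

/-- Auxiliary: number of leaves at even level, `b = true` meaning the current root is at
even level. -/
def eleafAux : LTree → Bool → ℕ
  | node _ ts, b => (cond b (if ts.isEmpty then 1 else 0) 0)
      + (ts.attach.map (fun s => eleafAux s.1 !b)).sum
decreasing_by exact sizeOf_lt_of_mem s.2

/-- `eleaf(T)`: the number of leaves of `T` at even level. -/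
def eleaf (T : LTree) : ℕ := eleafAux T true

/-- Auxiliary: given a word-statistic `f`, sum `f (wordOf u)` over all vertices `u` at even
level (`b = true` meaning the current root is at even level).  Since every vertex of a tree
is classified (as a double cyclic descent/ascent, cyclic peak/valley) by exactly one index
of the word of an even vertex — an even vertex by index `0` of its own word, an odd vertex
by its position in the word of its (even) parent — the corresponding tree statistics are
obtained by summing the word statistics over the even vertices. -/
def evenSum (f : List ℕ → ℕ) : LTree → Bool → ℕ
  | node a ts, b => (cond b (f (a :: ts.map label)) 0)
      + (ts.attach.map (fun s => evenSum f s.1 !b)).sum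
decreasing_by exact sizeOf_lt_of_mem s.2

/-- `dcdes(T)`: the number of vertices of `T` that are double cyclic descents. -/
def dcdes (T : LTree) : ℕ := evenSum dcdesW T true

/-- `dcasc(T)`: the number of vertices of `T` that are double cyclic ascents. -/
def dcasc (T : LTree) : ℕ := evenSum dcascW T true

/-- `cpeak(T)`: the number of vertices of `T` that are cyclic peaks. -/
def cpeak (T : LTree) : ℕ := evenSum cpeakW T true

/-- `cval(T)`: the number of vertices of `T` that are cyclic valleys. -/
def cval (T : LTree) : ℕ := evenSum cvalW T true

/-- Auxiliary: every odd vertex labeled `i` has exactly `k i - 1` children, all labeled `i`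
(`b = true` meaning the current root is at even level). -/
def oddOK (k : ℕ → ℕ) : LTree → Bool → Prop
  | node a ts, b => (b = false → (ts.length = k a - 1 ∧ ∀ s ∈ ts, s.label = a)) ∧
      ∀ s : {x // x ∈ ts}, oddOK k s.1 (!b)
decreasing_by exact sizeOf_lt_of_mem s.2

/-- Weakly increasing: the labels along the path from the root to any leaf are weakly
increasing from top to bottom, i.e. every child's label is at least its parent's label. -/
def incr : LTree → Prop
  | node a ts => (∀ s ∈ ts, a ≤ s.label) ∧ ∀ s : {x // x ∈ ts}, incr s.1
decreasing_by exact sizeOf_lt_of_mem s.2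

end LTree

/-- Membership in `𝒯_M` for `M = {1^{k 1}, …, n^{k n}}`: the multiset of vertex labels is
`{0} ∪ M`, the root is labeled `0`, and every odd vertex labeled `i` has exactly `k i - 1`
children, all labeled `i`. -/
def memTM (n : ℕ) (k : ℕ → ℕ) (T : LTree) : Prop :=
  T.label = 0 ∧ T.labels = 0 ::ₘ msetM n k ∧ T.oddOK k true

/-- Membership in `ℐ𝒯_M`: weakly increasing trees in `𝒯_M`. -/
def memIT (n : ℕ) (k : ℕ → ℕ) (T : LTree) : Prop :=
  memTM n k T ∧ T.incr

/-! ### Block insertion into words -/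

section Words

open MvPolynomial

/-- All words obtained from `w` by inserting the block `B` into one of its gaps. -/
def insertBlock (B : List ℕ) : List ℕ → List (List ℕ)
  | [] => [B]
  | y :: w => (B ++ y :: w) :: (insertBlock B w).map (y :: ·)

theorem mem_insertBlock {B w w' : List ℕ} :
    w' ∈ insertBlock B w ↔ ∃ l r, w = l ++ r ∧ w' = l ++ (B ++ r) := by
  induction w generalizing w' with
  | nil =>
    simp only [insertBlock, List.mem_singleton]
    constructor
    · rintro rfl; exact ⟨[], [], rfl, by simp⟩
    · rintro ⟨l, r, h, rfl⟩
      obtain ⟨rfl, rfl⟩ := List.append_eq_nil_iff.1 h.symm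
      simp
  | cons y w ih =>
    simp only [insertBlock, List.mem_cons, List.mem_map, ih]
    constructor
    · rintro (rfl | ⟨_, ⟨l, r, rfl, rfl⟩, rfl⟩)
      · exact ⟨[], y :: w, rfl, rfl⟩
      · exact ⟨y :: l, r, rfl, rfl⟩
    · rintro ⟨_ | ⟨x, l⟩, r, h, rfl⟩
      · left; simp_all
      · simp only [List.cons_append, List.cons.injEq] at h
        obtain ⟨rfl, rfl⟩ := h
        exact Or.inr ⟨_, ⟨l, r, rfl, rfl⟩, rfl⟩

theorem filter_ne_of_mem_insertBlock {m c : ℕ} {w w' : List ℕ} (hm : m ∉ w)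
    (h : w' ∈ insertBlock (List.replicate c m) w) : w'.filter (· ≠ m) = w := by
  obtain ⟨l, r, rfl, rfl⟩ := mem_insertBlock.1 h
  simp only [List.mem_append, not_or] at hm
  have hl : l.filter (· ≠ m) = l := List.filter_eq_self.2 fun a ha => by
    simpa using ne_of_mem_of_not_mem ha hm.1
  have hr : r.filter (· ≠ m) = r := List.filter_eq_self.2 fun a ha => by
    simpa using ne_of_mem_of_not_mem ha hm.2
  rw [List.filter_append, List.filter_append, hl, hr]
  simp

theorem nodup_insertBlock {m c : ℕ} (hc : 1 ≤ c) {w : List ℕ} (hm : m ∉ w) :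
    (insertBlock (List.replicate c m) w).Nodup := by
  induction w with
  | nil => simp [insertBlock]
  | cons y w ih =>
    simp only [List.mem_cons, not_or] at hm
    rw [insertBlock, List.nodup_cons]
    refine ⟨?_, (ih hm.2).map (List.cons_injective)⟩
    obtain ⟨c, rfl⟩ := Nat.exists_eq_succ_of_ne_zero (Nat.one_le_iff_ne_zero.1 hc)
    simp only [List.replicate_succ, List.cons_append, List.mem_map, List.cons.injEq, not_exists]
    rintro x ⟨-, h, -⟩
    exact hm.1 h.symm

theorem coe_of_mem_insertBlock {B w w' : List ℕ} (h : w' ∈ insertBlock B w) :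
    (w' : Multiset ℕ) = (w : Multiset ℕ) + (B : Multiset ℕ) := by
  obtain ⟨l, r, rfl, rfl⟩ := mem_insertBlock.1 h
  simp only [← Multiset.coe_add]
  abel

/-- The Stirling condition in terms of sublists. -/
theorem isStirling_iff_sublist {w : List ℕ} :
    IsStirling w ↔ ∀ a b, b < a → ¬ [a, b, a].Sublist w := by
  rw [IsStirling]
  constructor
  · intro h a b hab hs
    obtain ⟨f, hf⟩ := List.sublist_iff_exists_fin_orderEmbedding_get_eq.1 hs
    have h01 : f ⟨0, by simp⟩ < f ⟨1, by simp⟩ := f.lt_iff_lt.2 (by simp)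
    have h12 : f ⟨1, by simp⟩ < f ⟨2, by simp⟩ := f.lt_iff_lt.2 (by simp)
    have e0 := hf ⟨0, by simp⟩
    have e1 := hf ⟨1, by simp⟩
    have e2 := hf ⟨2, by simp⟩
    simp only [List.get_eq_getElem] at e0 e1 e2
    refine h ⟨_, (f ⟨2, by simp⟩).2, _, h12, _, h01, ?_⟩
    rw [List.getD_eq_getElem _ _ (f ⟨0, by simp⟩).2, List.getD_eq_getElem _ _ (f ⟨1, by simp⟩).2,
      List.getD_eq_getElem _ _ (f ⟨2, by simp⟩).2, ← e0, ← e1, ← e2]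
    exact ⟨rfl, hab⟩
  · rintro h ⟨k, hk, j, hj, i, hi, e, hlt⟩
    rw [List.getD_eq_getElem _ _ hk, List.getD_eq_getElem _ _ (by omega)] at e
    rw [List.getD_eq_getElem _ _ (by omega), List.getD_eq_getElem _ _ (by omega)] at hlt
    refine h _ _ hlt ?_
    have hij : [w[i], w[j]].Sublist (w.take k) := by
      have h1 : [w[i]].Sublist (w.take j) :=
        List.singleton_sublist.2 (List.mem_take_iff_getElem.2 ⟨i, by omega, rfl⟩)
      have h2 : [w[j]].Sublist ((w.take k).drop j) :=
        List.singleton_sublist.2 (List.mem_drop_iff_getElem.2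
          ⟨0, by simp; omega, by simp⟩)
      have h3 := h1.append h2
      have h4 : w.take j = (w.take k).take j := by rw [List.take_take, min_eq_left hj.le]
      rw [h4, List.take_append_drop] at h3
      exact h3
    have hk' : [w[i]].Sublist (w.drop k) := by
      rw [List.singleton_sublist, e]
      exact List.mem_drop_iff_getElem.2 ⟨0, by omega, by simp⟩
    simpa using hij.append hk'

theorem IsStirling.sublist {w w' : List ℕ} (h : IsStirling w) (hs : w'.Sublist w) :
    IsStirling w' := by
  rw [isStirling_iff_sublist] at *
  exact fun a b hab hw => h a b hab (hw.trans hs)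

theorem List.Sublist.of_cons_append_of_notMem {m : ℕ} {s l r : List ℕ} (hm : m ∉ l)
    (h : (m :: s).Sublist (l ++ r)) : (m :: s).Sublist r := by
  induction l with
  | nil => exact h
  | cons y l ih =>
    simp only [List.mem_cons, not_or] at hm
    rw [List.cons_append] at h
    rcases List.sublist_cons_iff.1 h with h | ⟨t, ht, -⟩
    · exact ih hm.2 h
    · exact absurd (List.cons.inj ht).1 hm.1

theorem IsStirling.insertBlock {m c : ℕ} {w w' : List ℕ} (hw : IsStirling w)
    (hm : ∀ y ∈ w, y < m) (h : w' ∈ insertBlock (List.replicate c m) w) : IsStirling w' := by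
  have hmw : m ∉ w := fun h => lt_irrefl _ (hm m h)
  have hf := filter_ne_of_mem_insertBlock hmw h
  rw [isStirling_iff_sublist] at *
  intro a b hab hs
  by_cases ham : a = m
  · subst ham
    obtain ⟨l, r, rfl, rfl⟩ := mem_insertBlock.1 h
    simp only [List.mem_append, not_or] at hmw
    have h1 := (List.sublist_cons_self _ _).trans
      (List.Sublist.of_cons_append_of_notMem hmw.1 hs)
    have h2 := List.Sublist.of_cons_append_of_notMem
      (fun hb => hab.ne (List.eq_of_mem_replicate hb)) h1
    exact hmw.2 (h2.subset (by simp))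
  · have ha : a ∈ w := by
      rw [← hf, List.mem_filter]
      exact ⟨hs.subset (by simp), by simpa using ham⟩
    have hbm : b ≠ m := (hab.trans (hm a ha)).ne
    have := hs.filter (· ≠ m)
    rw [hf] at this
    refine hw a b hab ?_
    simpa [ham, hbm] using this

theorem eq_replicate_append_of_not_sublist {m : ℕ} {w : List ℕ} (hm : ∀ y ∈ w, y ≤ m)
    (h : ∀ b < m, ¬ [b, m].Sublist w) :
    ∃ r, w = List.replicate (w.count m) m ++ r := by
  induction w with
  | nil => exact ⟨[], by simp⟩
  | cons y w ih =>
    by_cases hy : y = m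
    · subst hy
      obtain ⟨r, hr⟩ := ih (fun x hx => hm x (by simp [hx]))
        (fun b hb hs => h b hb (hs.cons _))
      refine ⟨r, ?_⟩
      rw [List.count_cons_self, List.replicate_succ, List.cons_append, ← hr]
    · refine ⟨y :: w, ?_⟩
      have : m ∉ w := fun hmw => h y (lt_of_le_of_ne (hm y (by simp)) hy)
        ((List.singleton_sublist.2 hmw).cons_cons y)
      rw [List.count_cons_of_ne hy, List.count_eq_zero.2 this]
      simp

theorem exists_mem_insertBlock {m c : ℕ} (hc : 1 ≤ c) {w : List ℕ} (hw : IsStirling w)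
    (hm : ∀ y ∈ w, y ≤ m) (hcount : w.count m = c) :
    ∃ w', w ∈ insertBlock (List.replicate c m) w' := by
  induction w with
  | nil => simp at hcount; omega
  | cons y w ih =>
    by_cases hy : y = m
    · subst hy
      obtain ⟨r, hr⟩ := eq_replicate_append_of_not_sublist (w := w) (m := y)
        (fun x hx => hm x (by simp [hx])) fun b hb hs =>
          isStirling_iff_sublist.1 hw y b hb (hs.cons_cons y)
      rw [List.count_cons_self] at hcount
      refine ⟨r, mem_insertBlock.2 ⟨[], r, rfl, ?_⟩⟩
      rw [← hcount, List.replicate_succ, List.cons_append, List.nil_append, ← hr]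
    · rw [List.count_cons_of_ne hy] at hcount
      obtain ⟨w', hw'⟩ := ih (hw.sublist (List.sublist_cons_self _ _))
        (fun x hx => hm x (by simp [hx])) hcount
      exact ⟨y :: w', by rw [insertBlock]; exact List.mem_cons_of_mem _ (List.mem_map_of_mem hw')⟩

theorem msetM_zero (k : ℕ → ℕ) : msetM 0 k = 0 := by simp [msetM]

theorem msetM_succ (n : ℕ) (k : ℕ → ℕ) :
    msetM (n + 1) k = msetM n k + Multiset.replicate (k (n + 1)) (n + 1) := by
  rw [msetM, msetM, Finset.sum_Icc_succ_top (by omega)]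

theorem mem_msetM {n : ℕ} {k : ℕ → ℕ} {a : ℕ} (h : a ∈ msetM n k) : 1 ≤ a ∧ a ≤ n := by
  obtain ⟨i, hi, ha⟩ := Multiset.mem_sum.1 h
  rw [Multiset.eq_of_mem_replicate ha]
  exact Finset.mem_Icc.1 hi

theorem count_msetM_le (n : ℕ) (k : ℕ → ℕ) (a : ℕ) : (msetM n k).count a ≤ k a := by
  induction n with
  | zero => simp [msetM_zero]
  | succ n ih =>
    rw [msetM_succ, Multiset.count_add, Multiset.count_replicate]
    split_ifs with h
    · subst h
      have : (msetM n k).count (n + 1) = 0 :=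
        Multiset.count_eq_zero.2 fun h => by have := mem_msetM h; omega
      omega
    · omega

theorem count_msetM_succ_self (n : ℕ) (k : ℕ → ℕ) :
    (msetM (n + 1) k).count (n + 1) = k (n + 1) := by
  rw [msetM_succ, Multiset.count_add, Multiset.count_replicate_self,
    Multiset.count_eq_zero.2 fun h => by have := mem_msetM h; omega, zero_add]

theorem card_msetM (n : ℕ) (k : ℕ → ℕ) :
    Multiset.card (msetM n k) = ∑ i ∈ Finset.Icc 1 n, k i := by
  simp [msetM]

/-- The Stirling permutations of `{1^{k 1}, …, n^{k n}}`, built by successive block insertion. -/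
def stirlingWords (k : ℕ → ℕ) : ℕ → List (List ℕ)
  | 0 => [[]]
  | n + 1 => (stirlingWords k n).flatMap (insertBlock (List.replicate (k (n + 1)) (n + 1)))

theorem mem_stirlingWords {n : ℕ} {k : ℕ → ℕ} (hk : ∀ i, 1 ≤ i → i ≤ n → 1 ≤ k i)
    {w : List ℕ} :
    w ∈ stirlingWords k n ↔ (w : Multiset ℕ) = msetM n k ∧ IsStirling w := by
  induction n generalizing w with
  | zero =>
    simp only [stirlingWords, List.mem_singleton, msetM_zero, Multiset.coe_eq_zero]
    constructor
    · rintro rfl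
      exact ⟨by simp, by simp [IsStirling]⟩
    · rintro ⟨h, -⟩; simpa using h
  | succ n ih =>
    have ih' := @ih (fun i h1 h2 => hk i h1 (by omega))
    simp only [stirlingWords, List.mem_flatMap, ih']
    constructor
    · rintro ⟨w', ⟨h1, h2⟩, h⟩
      refine ⟨?_, h2.insertBlock (fun y hy => ?_) h⟩
      · rw [coe_of_mem_insertBlock h, h1, msetM_succ, Multiset.coe_replicate]
      · have : y ∈ msetM n k := h1 ▸ Multiset.mem_coe.2 hy
        exact Nat.lt_succ_of_le (mem_msetM this).2
    · rintro ⟨h1, h2⟩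
      obtain ⟨w', hw'⟩ := exists_mem_insertBlock (m := n + 1) (c := k (n + 1))
        (hk _ (by omega) le_rfl) h2
        (fun y hy => (mem_msetM (h1 ▸ Multiset.mem_coe.2 hy : y ∈ msetM (n + 1) k)).2)
        (by rw [← Multiset.coe_count, h1, count_msetM_succ_self])
      have hco := coe_of_mem_insertBlock hw'
      rw [h1, msetM_succ, Multiset.coe_replicate] at hco
      refine ⟨w', ⟨(add_right_cancel hco).symm, h2.sublist ?_⟩, hw'⟩
      obtain ⟨l, r, rfl, rfl⟩ := mem_insertBlock.1 hw'
      exact (List.Sublist.refl l).append (List.sublist_append_right _ _)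

theorem nodup_stirlingWords {n : ℕ} {k : ℕ → ℕ} (hk : ∀ i, 1 ≤ i → i ≤ n → 1 ≤ k i) :
    (stirlingWords k n).Nodup := by
  induction n with
  | zero => simp [stirlingWords]
  | succ n ih =>
    have hk' : ∀ i, 1 ≤ i → i ≤ n → 1 ≤ k i := fun i h1 h2 => hk i h1 (by omega)
    have hnot : ∀ w ∈ stirlingWords k n, n + 1 ∉ w := fun w hw hn => by
      have := mem_msetM (((mem_stirlingWords hk').1 hw).1 ▸ Multiset.mem_coe.2 hn)
      omega
    rw [stirlingWords, List.nodup_flatMap]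
    refine ⟨fun w hw => nodup_insertBlock (hk _ (by omega) le_rfl) (hnot w hw), ?_⟩
    refine (ih hk').imp_of_mem fun {a b} ha hb hab => ?_
    intro w hwa hwb
    exact hab ((filter_ne_of_mem_insertBlock (hnot a ha) hwa).symm.trans
      (filter_ne_of_mem_insertBlock (hnot b hb) hwb))

theorem sPerms_msetM {n : ℕ} {k : ℕ → ℕ} (hk : ∀ i, 1 ≤ i → i ≤ n → 1 ≤ k i) :
    sPerms (msetM n k) = (stirlingWords k n).toFinset := by
  ext w
  rw [sPerms, Finset.mem_filter, permsOf, List.mem_toFinset, List.mem_toFinset,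
    mem_stirlingWords hk, List.mem_permutations, ← Multiset.coe_eq_coe, Multiset.coe_toList]

/-- The weight of a single gap of a word. -/
noncomputable def gapWeight (a b : ℕ) : MvPolynomial (Fin 3) ℤ :=
  if a < b then X 0 else if b < a then X 1 else X 2

/-- The product of the gap weights of `x w_1 … w_m 0`. -/
noncomputable def wordWeight : ℕ → List ℕ → MvPolynomial (Fin 3) ℤ
  | x, [] => gapWeight x 0
  | x, y :: w => gapWeight x y * wordWeight y w

theorem pow_countP_zip_eq_wordWeight (x : ℕ) (w : List ℕ) :
    (X 0 : MvPolynomial (Fin 3) ℤ) ^ (((x :: (w ++ [0])).zip (w ++ [0])).countP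
        fun p => decide (p.1 < p.2)) *
      X 1 ^ (((x :: (w ++ [0])).zip (w ++ [0])).countP fun p => decide (p.2 < p.1)) *
      X 2 ^ (((x :: (w ++ [0])).zip (w ++ [0])).countP fun p => decide (p.1 = p.2)) =
    wordWeight x w := by
  induction w generalizing x with
  | nil =>
    simp only [List.nil_append, List.zip_cons_cons, List.zip_nil_right, List.countP_cons,
      List.countP_nil, wordWeight, gapWeight, decide_eq_true_eq]
    rcases lt_trichotomy x 0 with h | h | h
    · omega
    · simp [h]
    · simp [h, h.ne', h.not_gt]
  | cons y w ih =>
    rw [wordWeight, ← ih y, List.cons_append, List.zip_cons_cons]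
    simp only [List.countP_cons, gapWeight, decide_eq_true_eq]
    rcases lt_trichotomy x y with h | h | h
    · simp only [h, h.ne, h.not_gt, if_true, if_false]; ring
    · simp only [h, lt_irrefl, if_true, if_false]; ring
    · simp only [h, h.ne', h.not_gt, if_true, if_false]; ring

theorem QPoly_eq_sum_wordWeight {n : ℕ} {k : ℕ → ℕ} (hk : ∀ i, 1 ≤ i → i ≤ n → 1 ≤ k i) :
    QPoly (msetM n k) = ((stirlingWords k n).map (wordWeight 0)).sum := by
  rw [QPoly, sPerms_msetM hk, ← List.sum_toFinset _ (nodup_stirlingWords hk)]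
  exact Finset.sum_congr rfl fun w _ => pow_countP_zip_eq_wordWeight 0 w

/-- The derivation `xy (∂_x + ∂_y + ∂_z)`. -/
noncomputable def wordDeriv : Derivation ℤ (MvPolynomial (Fin 3) ℤ) (MvPolynomial (Fin 3) ℤ) :=
  mkDerivation ℤ fun _ => X 0 * X 1

theorem wordDeriv_gapWeight (a b : ℕ) : wordDeriv (gapWeight a b) = X 0 * X 1 := by
  unfold gapWeight wordDeriv
  split_ifs <;> simp [mkDerivation_X]

theorem wordWeight_replicate_append (m c : ℕ) (w : List ℕ) :
    wordWeight m (List.replicate c m ++ w) = X 2 ^ c * wordWeight m w := by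
  induction c with
  | zero => simp
  | succ c ih =>
    rw [List.replicate_succ, List.cons_append, wordWeight, ih, pow_succ]
    simp only [gapWeight, lt_irrefl, if_false]
    ring

theorem sum_wordWeight_insertBlock {m c : ℕ} (hc : 1 ≤ c) {x : ℕ} {w : List ℕ} (hx : x < m)
    (hm : ∀ y ∈ w, y < m) :
    ((insertBlock (List.replicate c m) w).map (wordWeight x)).sum =
      X 2 ^ (c - 1) * wordDeriv (wordWeight x w) := by
  obtain ⟨c, rfl⟩ := Nat.exists_eq_succ_of_ne_zero (Nat.one_le_iff_ne_zero.1 hc)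
  have hblock : ∀ x < m, ∀ w, wordWeight x (List.replicate (c + 1) m ++ w) =
      X 0 * (X 2 ^ c * wordWeight m w) := fun x hx w => by
    rw [List.replicate_succ, List.cons_append, wordWeight, wordWeight_replicate_append,
      gapWeight, if_pos hx]
  induction w generalizing x with
  | nil =>
    have h0 : 0 < m := by omega
    have := hblock x hx []
    rw [List.append_nil] at this
    simp only [insertBlock, List.map_cons, List.map_nil, List.sum_singleton, wordWeight] at this ⊢
    rw [this, wordDeriv_gapWeight, gapWeight, if_neg (by omega), if_pos h0]
    simp only [Nat.succ_sub_one]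
    ring
  | cons y w ih =>
    have hy : y < m := hm y (by simp)
    rw [insertBlock, List.map_cons, List.sum_cons, hblock x hx, List.map_map]
    have : (wordWeight x ∘ fun l => y :: l) = fun l => gapWeight x y * wordWeight y l := by
      ext1 l; simp [wordWeight]
    rw [this, List.sum_map_mul_left, ih hy fun z hz => hm z (by simp [hz])]
    simp only [wordWeight, Derivation.leibniz, wordDeriv_gapWeight, smul_eq_mul]
    rw [show gapWeight m y = X 1 by rw [gapWeight, if_neg (by omega), if_pos hy]]
    simp only [Nat.succ_sub_one]
    ring

theorem List.sum_map_flatMap {α β R : Type*} [AddMonoid R] (l : List α) (f : α → List β)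
    (g : β → R) : ((l.flatMap f).map g).sum = (l.map fun a => ((f a).map g).sum).sum := by
  induction l with
  | nil => simp
  | cons a l ih => simp [ih]

theorem QPoly_msetM_zero (k : ℕ → ℕ) : QPoly (msetM 0 k) = X 2 := by
  rw [QPoly_eq_sum_wordWeight (by omega)]
  simp [stirlingWords, wordWeight, gapWeight]

theorem QPoly_msetM_succ {n : ℕ} {k : ℕ → ℕ} (hk : ∀ i, 1 ≤ i → i ≤ n + 1 → 1 ≤ k i) :
    QPoly (msetM (n + 1) k) = X 2 ^ (k (n + 1) - 1) * wordDeriv (QPoly (msetM n k)) := by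
  have hk' : ∀ i, 1 ≤ i → i ≤ n → 1 ≤ k i := fun i h1 h2 => hk i h1 (by omega)
  rw [QPoly_eq_sum_wordWeight hk, QPoly_eq_sum_wordWeight hk', stirlingWords,
    List.sum_map_flatMap, map_list_sum, ← List.sum_map_mul_left, List.map_map]
  congr 1
  refine List.map_congr_left fun w hw => ?_
  refine sum_wordWeight_insertBlock (hk _ (by omega) le_rfl) (by omega) fun y hy => ?_
  have := mem_msetM (((mem_stirlingWords hk').1 hw).1 ▸ Multiset.mem_coe.2 hy)
  omega

end Words

/-! ### Forests and vertex insertion -/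

namespace LTree

theorem forest_induction {P : List LTree → Prop} (nil : P [])
    (cons : ∀ a ss ts, P ss → P ts → P (node a ss :: ts)) : ∀ l, P l
  | [] => nil
  | node a ss :: ts => cons a ss ts (forest_induction nil cons ss) (forest_induction nil cons ts)

theorem cdes_node (a : ℕ) (ts : List LTree) :
    (node a ts).cdes = cdesW (a :: ts.map label) + (ts.map cdes).sum := by
  rw [cdes, List.attach_map_val (f := cdes)]

theorem eleafAux_node (a : ℕ) (ts : List LTree) (b : Bool) :
    (node a ts).eleafAux b = (cond b (if ts.isEmpty then 1 else 0) 0) +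
      (ts.map (eleafAux · !b)).sum := by
  rw [eleafAux, List.attach_map_val (f := fun s : LTree => s.eleafAux !b)]

theorem evenSum_node (f : List ℕ → ℕ) (a : ℕ) (ts : List LTree) (b : Bool) :
    (node a ts).evenSum f b = (cond b (f (a :: ts.map label)) 0) +
      (ts.map (evenSum f · !b)).sum := by
  rw [evenSum, List.attach_map_val (f := fun s : LTree => s.evenSum f !b)]

theorem oddOK_node (k : ℕ → ℕ) (a : ℕ) (ts : List LTree) (b : Bool) :
    (node a ts).oddOK k b ↔ (b = false → (ts.length = k a - 1 ∧ ∀ s ∈ ts, s.label = a)) ∧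
      ∀ s ∈ ts, s.oddOK k !b := by
  rw [oddOK]
  simp

theorem incr_node (a : ℕ) (ts : List LTree) :
    (node a ts).incr ↔ (∀ s ∈ ts, a ≤ s.label) ∧ ∀ s ∈ ts, s.incr := by
  rw [incr]
  simp

/-- The multiset of all vertex labels of a forest. -/
def forestLabels (ts : List LTree) : Multiset ℕ := (ts.map labels).sum

@[simp] theorem forestLabels_nil : forestLabels [] = 0 := rfl

theorem labels_node (a : ℕ) (ts : List LTree) : (node a ts).labels = a ::ₘ forestLabels ts := by
  rw [labels, forestLabels, List.attach_map_val (f := labels)]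

@[simp] theorem forestLabels_cons (a : ℕ) (ss ts : List LTree) :
    forestLabels (node a ss :: ts) = (a ::ₘ forestLabels ss) + forestLabels ts := by
  rw [forestLabels, List.map_cons, List.sum_cons, labels_node, forestLabels, forestLabels]

theorem forestLabels_replicate (m c : ℕ) :
    forestLabels (List.replicate c (node m [])) = Multiset.replicate c m := by
  induction c with
  | zero => simp
  | succ c ih => simp [List.replicate_succ, Multiset.replicate_succ, ih]

mutual

/-- `EvenGood k ts a`: the forest `ts` may hang below an even vertex labeled `a`; it is increasing
with distinct sibling labels, and every odd vertex labeled `i` has `k i - 1` children,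
all labeled `i`. -/
def EvenGood (k : ℕ → ℕ) : List LTree → ℕ → Prop
  | [], _ => True
  | node y ss :: ts, a => a < y ∧ y ∉ forestLabels ts ∧ ss.length = k y - 1 ∧
      OddGood k ss y ∧ EvenGood k ts a

/-- `OddGood k ss a`: the forest `ss` may hang below an odd vertex labeled `a`, up to its length. -/
def OddGood (k : ℕ → ℕ) : List LTree → ℕ → Prop
  | [], _ => True
  | node s ts :: ss, a => s = a ∧ EvenGood k ts a ∧ OddGood k ss a

end

theorem evenGood_cons {k : ℕ → ℕ} {y a : ℕ} {ss ts : List LTree} :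
    EvenGood k (node y ss :: ts) a ↔ a < y ∧ y ∉ forestLabels ts ∧ ss.length = k y - 1 ∧
      OddGood k ss y ∧ EvenGood k ts a := by
  rw [EvenGood]

theorem oddGood_cons {k : ℕ → ℕ} {s a : ℕ} {ts ss : List LTree} :
    OddGood k (node s ts :: ss) a ↔ s = a ∧ EvenGood k ts a ∧ OddGood k ss a := by
  rw [OddGood]

mutual

/-- All forests obtained from the forest `ts` below an even vertex by inserting the tree `N`
below some even vertex, except as the first child of the parent of `ts`. -/
def evenInsert (N : LTree) : List LTree → List (List LTree)
  | [] => []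
  | node y ss :: ts => (oddInsert N ss).map (node y · :: ts) ++
      ((N :: ts) :: evenInsert N ts).map (node y ss :: ·)

/-- All forests obtained from the forest `ss` below an odd vertex by inserting the tree `N`
below some even vertex. -/
def oddInsert (N : LTree) : List LTree → List (List LTree)
  | [] => []
  | node s ts :: ss => ((N :: ts) :: evenInsert N ts).map (node s · :: ss) ++
      (oddInsert N ss).map (node s ts :: ·)

end

/-- An odd vertex labeled `m` with `c` leaves labeled `m` as children. -/
def star (m c : ℕ) : LTree := node m (List.replicate c (node m []))

theorem labels_star (m c : ℕ) : (star m c).labels = Multiset.replicate (c + 1) m := by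
  rw [star, labels_node, forestLabels_replicate, Multiset.replicate_succ]

theorem forestLabels_star_cons (m c : ℕ) (ts : List LTree) :
    forestLabels (star m c :: ts) = forestLabels ts + Multiset.replicate (c + 1) m := by
  rw [star, forestLabels_cons, ← labels_node, ← star, labels_star, add_comm]

theorem forestLabels_insert (m c : ℕ) (ts : List LTree) :
    (∀ ts' ∈ evenInsert (star m c) ts,
      forestLabels ts' = forestLabels ts + Multiset.replicate (c + 1) m) ∧
    (∀ ts' ∈ oddInsert (star m c) ts,
      forestLabels ts' = forestLabels ts + Multiset.replicate (c + 1) m) := by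
  induction ts using forest_induction with
  | nil => simp [evenInsert, oddInsert]
  | cons y ss ts ihs iht =>
    constructor
    · intro ts' h
      simp only [evenInsert, List.mem_append, List.mem_map, List.mem_cons] at h
      rcases h with ⟨ss', h, rfl⟩ | ⟨_, rfl | h, rfl⟩
      · rw [forestLabels_cons, ihs.2 _ h, forestLabels_cons, ← Multiset.cons_add]; abel
      · rw [forestLabels_cons, forestLabels_star_cons, forestLabels_cons]; abel
      · rw [forestLabels_cons, iht.1 _ h, forestLabels_cons]; abel
    · intro ts' h
      simp only [oddInsert, List.mem_append, List.mem_map, List.mem_cons] at h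
      rcases h with ⟨_, rfl | h, rfl⟩ | ⟨_, h, rfl⟩
      · rw [forestLabels_cons, forestLabels_star_cons, forestLabels_cons, ← Multiset.cons_add]; abel
      · rw [forestLabels_cons, ihs.1 _ h, forestLabels_cons, ← Multiset.cons_add]; abel
      · rw [forestLabels_cons, iht.2 _ h, forestLabels_cons]; abel

theorem length_of_mem_oddInsert {N : LTree} {ss ss' : List LTree} (h : ss' ∈ oddInsert N ss) :
    ss'.length = ss.length := by
  induction ss generalizing ss' with
  | nil => simp [oddInsert] at h
  | cons s ss ih =>
    obtain ⟨s, ts⟩ := s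
    simp only [oddInsert, List.mem_append, List.mem_map] at h
    rcases h with ⟨_, -, rfl⟩ | ⟨_, h, rfl⟩
    · simp
    · simp [ih h]

theorem oddGood_replicate (k : ℕ → ℕ) (m c : ℕ) :
    OddGood k (List.replicate c (node m [])) m := by
  induction c with
  | zero => simp [OddGood]
  | succ c ih => simp [List.replicate_succ, OddGood, EvenGood, ih]

theorem EvenGood.star_cons {k : ℕ → ℕ} {m a : ℕ} {ts : List LTree} (h : EvenGood k ts a)
    (ha : a < m) (hm : ∀ y ∈ forestLabels ts, y < m) :
    EvenGood k (star m (k m - 1) :: ts) a := by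
  rw [star, EvenGood]
  exact ⟨ha, fun h => lt_irrefl _ (hm m h), by simp, oddGood_replicate k m _, h⟩

theorem good_insert {k : ℕ → ℕ} {m : ℕ} (ts : List LTree) (hm : ∀ y ∈ forestLabels ts, y < m) :
    (∀ a, a < m → EvenGood k ts a → ∀ ts' ∈ evenInsert (star m (k m - 1)) ts, EvenGood k ts' a) ∧
    (∀ a, OddGood k ts a → ∀ ts' ∈ oddInsert (star m (k m - 1)) ts, OddGood k ts' a) := by
  induction ts using forest_induction with
  | nil => simp [evenInsert, oddInsert]
  | cons y ss ts ihs iht =>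
    simp only [forestLabels_cons, Multiset.mem_add, Multiset.mem_cons] at hm
    have hy : y < m := hm y (by simp)
    have hss : ∀ z ∈ forestLabels ss, z < m := fun z hz => hm z (by simp [hz])
    have hts : ∀ z ∈ forestLabels ts, z < m := fun z hz => hm z (by simp [hz])
    have ihs := ihs hss
    have iht := iht hts
    constructor
    · intro a ha hg ts' h
      rw [EvenGood] at hg
      obtain ⟨h1, h2, h3, h4, h5⟩ := hg
      simp only [evenInsert, List.mem_append, List.mem_map, List.mem_cons] at h
      have hy' : y ∉ forestLabels ts + Multiset.replicate (k m - 1 + 1) m := by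
        rw [Multiset.mem_add, not_or]
        exact ⟨h2, fun h => hy.ne (Multiset.eq_of_mem_replicate h)⟩
      rcases h with ⟨ss', h, rfl⟩ | ⟨_, rfl | h, rfl⟩
      · exact evenGood_cons.2 ⟨h1, h2, (length_of_mem_oddInsert h).trans h3, ihs.2 _ h4 _ h, h5⟩
      · exact evenGood_cons.2 ⟨h1, by rwa [forestLabels_star_cons], h3, h4, h5.star_cons ha hts⟩
      · exact evenGood_cons.2 ⟨h1, by rwa [(forestLabels_insert _ _ _).1 _ h], h3, h4, iht.1 _ ha h5 _ h⟩
    · intro a hg ts' h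
      rw [OddGood] at hg
      obtain ⟨rfl, h2, h3⟩ := hg
      simp only [oddInsert, List.mem_append, List.mem_map, List.mem_cons] at h
      rcases h with ⟨_, rfl | h, rfl⟩ | ⟨_, h, rfl⟩
      · exact oddGood_cons.2 ⟨rfl, h2.star_cons hy hss, h3⟩
      · exact oddGood_cons.2 ⟨rfl, ihs.1 _ hy h2 _ h, h3⟩
      · exact oddGood_cons.2 ⟨rfl, h2, iht.2 _ h3 _ h⟩

/-- Remove all vertices labeled `m`, together with their descendants. -/
def prune (m : ℕ) : List LTree → List LTree
  | [] => []
  | node y ss :: ts => if y = m then prune m ts else node y (prune m ss) :: prune m ts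

theorem prune_eq_self {m : ℕ} {ts : List LTree} (hm : m ∉ forestLabels ts) : prune m ts = ts := by
  induction ts using forest_induction with
  | nil => simp [prune]
  | cons y ss ts ihs iht =>
    simp only [forestLabels_cons, Multiset.mem_add, Multiset.mem_cons, not_or] at hm
    rw [prune, if_neg (Ne.symm hm.1.1), ihs hm.1.2, iht hm.2]

theorem prune_star_cons (m c : ℕ) (ts : List LTree) : prune m (star m c :: ts) = prune m ts := by
  rw [star, prune, if_pos rfl]

theorem prune_insert {m c : ℕ} (ts : List LTree) (hm : m ∉ forestLabels ts) :
    (∀ ts' ∈ evenInsert (star m c) ts, prune m ts' = ts) ∧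
    (∀ ts' ∈ oddInsert (star m c) ts, prune m ts' = ts) := by
  induction ts using forest_induction with
  | nil => simp [evenInsert, oddInsert]
  | cons y ss ts ihs iht =>
    simp only [forestLabels_cons, Multiset.mem_add, Multiset.mem_cons, not_or] at hm
    have hy : y ≠ m := Ne.symm hm.1.1
    constructor
    · intro ts' h
      simp only [evenInsert, List.mem_append, List.mem_map, List.mem_cons] at h
      rcases h with ⟨ss', h, rfl⟩ | ⟨_, rfl | h, rfl⟩
      · rw [prune, if_neg hy, (ihs hm.1.2).2 _ h, prune_eq_self hm.2]
      · rw [prune, if_neg hy, prune_star_cons, prune_eq_self hm.1.2, prune_eq_self hm.2]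
      · rw [prune, if_neg hy, prune_eq_self hm.1.2, (iht hm.2).1 _ h]
    · intro ts' h
      simp only [oddInsert, List.mem_append, List.mem_map, List.mem_cons] at h
      rcases h with ⟨_, rfl | h, rfl⟩ | ⟨_, h, rfl⟩
      · rw [prune, if_neg hy, prune_star_cons, prune_eq_self hm.1.2, prune_eq_self hm.2]
      · rw [prune, if_neg hy, (ihs hm.1.2).1 _ h, prune_eq_self hm.2]
      · rw [prune, if_neg hy, prune_eq_self hm.1.2, (iht hm.2).2 _ h]

theorem star_cons_notMem_evenInsert {m c : ℕ} {N : LTree} {ts ts' : List LTree}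
    (hm : m ∉ forestLabels ts) : star m c :: ts' ∉ evenInsert N ts := by
  intro h
  rcases ts with _ | ⟨⟨y, ss⟩, ts⟩
  · simp [evenInsert] at h
  · simp only [forestLabels_cons, Multiset.mem_add, Multiset.mem_cons, not_or] at hm
    simp only [evenInsert, star, List.mem_append, List.mem_map, List.cons.injEq, node.injEq] at h
    rcases h with ⟨_, _, ⟨h, _⟩, _⟩ | ⟨_, _, ⟨h, _⟩, _⟩ <;> exact hm.1.1 h.symm

theorem self_notMem_insert (m c : ℕ) (ts : List LTree) :
    ts ∉ evenInsert (star m c) ts ∧ ts ∉ oddInsert (star m c) ts := by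
  constructor <;> intro h
  · have := congrArg Multiset.card ((forestLabels_insert m c ts).1 _ h)
    rw [Multiset.card_add, Multiset.card_replicate] at this
    omega
  · have := congrArg Multiset.card ((forestLabels_insert m c ts).2 _ h)
    rw [Multiset.card_add, Multiset.card_replicate] at this
    omega

theorem nodup_insert {m c : ℕ} (ts : List LTree) (hm : m ∉ forestLabels ts) :
    (evenInsert (star m c) ts).Nodup ∧ (oddInsert (star m c) ts).Nodup := by
  induction ts using forest_induction with
  | nil => simp [evenInsert, oddInsert]
  | cons y ss ts ihs iht =>
    simp only [forestLabels_cons, Multiset.mem_add, Multiset.mem_cons, not_or] at hm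
    have ihs := ihs hm.1.2
    have iht := iht hm.2
    have inj_left : Function.Injective (node y · :: ts) := fun a b h => by simpa using h
    constructor
    · rw [evenInsert, List.nodup_append']
      refine ⟨ihs.2.map inj_left, (List.nodup_cons.2
        ⟨star_cons_notMem_evenInsert hm.2, iht.1⟩).map List.cons_injective, ?_⟩
      intro l h1 h2
      obtain ⟨ss', h, rfl⟩ := List.mem_map.1 h1
      obtain ⟨ts', -, e⟩ := List.mem_map.1 h2
      simp only [List.cons.injEq, node.injEq, true_and] at e
      exact (self_notMem_insert m c ss).2 (e.1 ▸ h)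
    · rw [oddInsert, List.nodup_append']
      refine ⟨(List.nodup_cons.2 ⟨star_cons_notMem_evenInsert hm.1.2, ihs.1⟩).map inj_left,
        iht.2.map List.cons_injective, ?_⟩
      intro l h1 h2
      obtain ⟨ss', -, rfl⟩ := List.mem_map.1 h1
      obtain ⟨ts', h, e⟩ := List.mem_map.1 h2
      simp only [List.cons.injEq] at e
      exact (self_notMem_insert m c ts).2 (e.2 ▸ h)

theorem OddGood.eq_replicate {k : ℕ → ℕ} {m : ℕ} {ss : List LTree} (h : OddGood k ss m)
    (hm : ∀ y ∈ forestLabels ss, y ≤ m) : ss = List.replicate ss.length (node m []) := by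
  induction ss with
  | nil => rfl
  | cons s ss ih =>
    obtain ⟨s, ts⟩ := s
    rw [OddGood] at h
    obtain ⟨rfl, h1, h2⟩ := h
    simp only [forestLabels_cons, Multiset.mem_add, Multiset.mem_cons] at hm
    rw [List.length_cons, List.replicate_succ, ← ih h2 fun y hy => hm y (by simp [hy])]
    rcases ts with _ | ⟨⟨y, us⟩, ts⟩
    · rfl
    · rw [EvenGood] at h1
      exact absurd h1.1 (not_lt.2 (hm y (by simp)))

theorem exists_mem_insert {k : ℕ → ℕ} {m : ℕ} (hk : 1 ≤ k m) (ts : List LTree)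
    (hm : ∀ y ∈ forestLabels ts, y ≤ m) :
    (∀ a, a < m → EvenGood k ts a → (forestLabels ts).count m = 0 ∨
      (k m ≤ (forestLabels ts).count m ∧ ((forestLabels ts).count m = k m →
        ∃ ts', EvenGood k ts' a ∧
          ts ∈ (star m (k m - 1) :: ts') :: evenInsert (star m (k m - 1)) ts'))) ∧
    (∀ a, a < m → OddGood k ts a → (forestLabels ts).count m = 0 ∨
      (k m ≤ (forestLabels ts).count m ∧ ((forestLabels ts).count m = k m →
        ∃ ts', OddGood k ts' a ∧ ts ∈ oddInsert (star m (k m - 1)) ts'))) := by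
  induction ts using forest_induction with
  | nil => simp
  | cons y ss ts ihs iht =>
    simp only [forestLabels_cons, Multiset.mem_add, Multiset.mem_cons] at hm
    have hss : ∀ z ∈ forestLabels ss, z ≤ m := fun z hz => hm z (by simp [hz])
    have ihs := ihs hss
    have iht := iht fun z hz => hm z (by simp [hz])
    simp only [forestLabels_cons, Multiset.count_add]
    constructor
    · intro a ha hg
      rw [EvenGood] at hg
      obtain ⟨h1, h2, h3, h4, h5⟩ := hg
      by_cases hy : y = m
      · subst hy
        have hrep := h4.eq_replicate hss
        rw [h3] at hrep
        have hcs : Multiset.count y (y ::ₘ forestLabels ss) = k y := by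
          rw [hrep, forestLabels_replicate, Multiset.count_cons_self,
            Multiset.count_replicate_self]
          omega
        rw [hcs]
        refine Or.inr ⟨by omega, fun _ => ⟨ts, h5, ?_⟩⟩
        rw [star, ← hrep]
        simp
      · have hlt : y < m := lt_of_le_of_ne (hm y (by simp)) hy
        rw [Multiset.count_cons_of_ne (Ne.symm hy)]
        rcases ihs.2 y hlt h4 with hs | ⟨hs, hs'⟩ <;> rcases iht.1 a ha h5 with ht | ⟨ht, ht'⟩
        · left; omega
        · refine Or.inr ⟨by omega, fun h => ?_⟩
          obtain ⟨ts', hg, hmem⟩ := ht' (by omega)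
          refine ⟨node y ss :: ts', evenGood_cons.2 ⟨h1, fun hyt => h2 ?_, h3, h4, hg⟩, ?_⟩
          · rcases List.mem_cons.1 hmem with rfl | hmem
            · rw [forestLabels_star_cons]; exact Multiset.mem_add.2 (Or.inl hyt)
            · rw [(forestLabels_insert _ _ _).1 _ hmem]; exact Multiset.mem_add.2 (Or.inl hyt)
          · rw [evenInsert]
            exact List.mem_cons_of_mem _ (List.mem_append_right _ (List.mem_map_of_mem hmem))
        · refine Or.inr ⟨by omega, fun h => ?_⟩
          obtain ⟨ss', hg, hmem⟩ := hs' (by omega)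
          refine ⟨node y ss' :: ts, evenGood_cons.2
            ⟨h1, h2, (length_of_mem_oddInsert hmem).symm.trans h3, hg, h5⟩, ?_⟩
          rw [evenInsert]
          exact List.mem_cons_of_mem _ (List.mem_append_left _
            (List.mem_map.2 ⟨ss, hmem, rfl⟩))
        · exact Or.inr ⟨by omega, fun h => by omega⟩
    · intro a ha hg
      rw [OddGood] at hg
      obtain ⟨rfl, h2, h3⟩ := hg
      rw [Multiset.count_cons_of_ne ha.ne']
      rcases ihs.1 y ha h2 with hs | ⟨hs, hs'⟩ <;> rcases iht.2 y ha h3 with ht | ⟨ht, ht'⟩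
      · left; omega
      · refine Or.inr ⟨by omega, fun h => ?_⟩
        obtain ⟨ts', hg, hmem⟩ := ht' (by omega)
        refine ⟨node y ss :: ts', oddGood_cons.2 ⟨rfl, h2, hg⟩, ?_⟩
        rw [oddInsert]
        exact List.mem_append_right _ (List.mem_map_of_mem hmem)
      · refine Or.inr ⟨by omega, fun h => ?_⟩
        obtain ⟨ss', hg, hmem⟩ := hs' (by omega)
        refine ⟨node y ss' :: ts, oddGood_cons.2 ⟨rfl, hg, h3⟩, ?_⟩
        rw [oddInsert]
        exact List.mem_append_left _ (List.mem_map.2 ⟨ss, hmem, rfl⟩)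
      · exact Or.inr ⟨by omega, fun h => by omega⟩

end LTree

/-! ### Weakly increasing trees as iterated insertions -/

namespace LTree

theorem length_le_count_forestLabels {ss : List LTree} {a : ℕ} (h : ∀ s ∈ ss, s.label = a) :
    ss.length ≤ (forestLabels ss).count a := by
  induction ss with
  | nil => simp
  | cons s ss ih =>
    obtain ⟨s, ts⟩ := s
    have hs : s = a := h (node s ts) (by simp)
    subst hs
    have := ih fun t ht => h t (by simp [ht])
    rw [forestLabels_cons, Multiset.count_add, Multiset.count_cons_self, List.length_cons]
    omega

theorem good_of_incr {k : ℕ → ℕ} (ts : List LTree) :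
    (∀ a, (∀ t ∈ ts, a ≤ t.label) → (∀ t ∈ ts, t.oddOK k false) → (∀ t ∈ ts, t.incr) →
      (∀ j, (forestLabels ts).count j ≤ k j) → (forestLabels ts).count a = 0 →
      EvenGood k ts a) ∧
    (∀ a, (∀ t ∈ ts, t.label = a) → (∀ t ∈ ts, t.oddOK k true) → (∀ t ∈ ts, t.incr) →
      (∀ j, j ≠ a → (forestLabels ts).count j ≤ k j) → (forestLabels ts).count a ≤ ts.length →
      OddGood k ts a) := by
  induction ts using forest_induction with
  | nil => simp [EvenGood, OddGood]
  | cons y ss ts ihs iht =>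
    simp only [List.forall_mem_cons, forestLabels_cons, Multiset.count_add, List.length_cons]
    constructor
    · rintro a ⟨hl, hl'⟩ ⟨ho, ho'⟩ ⟨hi, hi'⟩ hc h0
      rw [oddOK_node] at ho
      rw [incr_node] at hi
      obtain ⟨hlen, hlab⟩ := ho.1 rfl
      have hcy := hc y
      have hle := length_le_count_forestLabels hlab
      rw [Multiset.count_cons_self] at hcy
      refine evenGood_cons.2 ⟨lt_of_le_of_ne hl ?_, ?_, hlen, ihs.2 y hlab ho.2 hi.2 ?_ (by omega),
        iht.1 a hl' ho' hi' (fun j => le_trans (by omega) (hc j)) (by omega)⟩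
      · rintro rfl
        simp at h0
      · rw [← Multiset.count_eq_zero]
        omega
      · intro j hj
        have := hc j
        rw [Multiset.count_cons_of_ne hj] at this
        omega
    · rintro a ⟨hl, hl'⟩ ⟨ho, ho'⟩ ⟨hi, hi'⟩ hc h0
      rw [oddOK_node] at ho
      rw [incr_node] at hi
      have hy : y = a := hl
      subst hy
      have hle := length_le_count_forestLabels hl'
      rw [Multiset.count_cons_self] at h0
      refine oddGood_cons.2 ⟨rfl, ihs.1 y hi.1 ho.2 hi.2 (fun j => ?_) (by omega),
        iht.2 y hl' ho' hi' (fun j hj => le_trans (by omega) (hc j hj)) (by omega)⟩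
      by_cases hj : j = y
      · subst hj; omega
      · have := hc j hj
        rw [Multiset.count_cons_of_ne hj] at this
        omega

theorem incr_of_good {k : ℕ → ℕ} (ts : List LTree) :
    (∀ a, EvenGood k ts a →
      (∀ t ∈ ts, a ≤ t.label) ∧ (∀ t ∈ ts, t.oddOK k false) ∧ (∀ t ∈ ts, t.incr)) ∧
    (∀ a, OddGood k ts a →
      (∀ t ∈ ts, t.label = a) ∧ (∀ t ∈ ts, t.oddOK k true) ∧ (∀ t ∈ ts, t.incr)) := by
  induction ts using forest_induction with
  | nil => simp
  | cons y ss ts ihs iht =>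
    simp only [List.forall_mem_cons, oddOK_node, incr_node]
    constructor
    · intro a hg
      obtain ⟨h1, -, h3, h4, h5⟩ := evenGood_cons.1 hg
      obtain ⟨i1, i2, i3⟩ := ihs.2 y h4
      obtain ⟨j1, j2, j3⟩ := iht.1 a h5
      exact ⟨⟨h1.le, j1⟩, ⟨⟨fun _ => ⟨h3, i1⟩, i2⟩, j2⟩, ⟨fun s hs => (i1 s hs).ge, i3⟩, j3⟩
    · intro a hg
      obtain ⟨rfl, h2, h3⟩ := oddGood_cons.1 hg
      obtain ⟨i1, i2, i3⟩ := ihs.1 y h2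
      obtain ⟨j1, j2, j3⟩ := iht.2 y h3
      exact ⟨⟨rfl, j1⟩, ⟨⟨by simp, i2⟩, j2⟩, ⟨i1, i3⟩, j3⟩

theorem memIT_node_zero {n : ℕ} {k : ℕ → ℕ} {ts : List LTree} :
    memIT n k (node 0 ts) ↔ EvenGood k ts 0 ∧ forestLabels ts = msetM n k := by
  rw [memIT, memTM, oddOK_node, incr_node, labels_node]
  simp only [label, true_and, Multiset.cons_inj_right, Bool.not_true, reduceCtorEq,
    false_imp_iff]
  constructor
  · rintro ⟨⟨h1, h2⟩, h3, h4⟩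
    refine ⟨(good_of_incr ts).1 0 h3 h2 h4 (fun j => h1 ▸ count_msetM_le n k j) ?_, h1⟩
    rw [h1, Multiset.count_eq_zero]
    exact fun h => absurd (mem_msetM h).1 (by omega)
  · rintro ⟨h1, h2⟩
    obtain ⟨h3, h4, h5⟩ := (incr_of_good ts).1 0 h1
    exact ⟨⟨h2, h4⟩, h3, h5⟩

/-- The forests below the roots of the weakly increasing trees for `{1^{k 1}, …, n^{k n}}`,
built by successive insertion. -/
def rootForests (k : ℕ → ℕ) : ℕ → List (List LTree)
  | 0 => [[]]
  | n + 1 => (rootForests k n).flatMap fun ts =>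
      (star (n + 1) (k (n + 1) - 1) :: ts) :: evenInsert (star (n + 1) (k (n + 1) - 1)) ts

theorem mem_rootForests {n : ℕ} {k : ℕ → ℕ} (hk : ∀ i, 1 ≤ i → i ≤ n → 1 ≤ k i)
    {ts : List LTree} :
    ts ∈ rootForests k n ↔ EvenGood k ts 0 ∧ forestLabels ts = msetM n k := by
  induction n generalizing ts with
  | zero =>
    simp only [rootForests, List.mem_singleton, msetM_zero]
    constructor
    · rintro rfl
      simp [EvenGood]
    · rintro ⟨-, h⟩
      rcases ts with _ | ⟨⟨y, ss⟩, ts⟩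
      · rfl
      · simp at h
  | succ n ih =>
    have ih' := @ih (fun i h1 h2 => hk i h1 (by omega))
    have hk1 : 1 ≤ k (n + 1) := hk _ (by omega) le_rfl
    have hlab : ∀ ts ts' : List LTree,
        ts' ∈ (star (n + 1) (k (n + 1) - 1) :: ts) ::
          evenInsert (star (n + 1) (k (n + 1) - 1)) ts →
        forestLabels ts' = forestLabels ts + Multiset.replicate (k (n + 1)) (n + 1) := by
      intro ts ts' h
      rw [← Nat.sub_add_cancel hk1]
      rcases List.mem_cons.1 h with rfl | h
      · exact forestLabels_star_cons _ _ _
      · exact (forestLabels_insert _ _ _).1 _ h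
    simp only [rootForests, List.mem_flatMap, ih']
    constructor
    · rintro ⟨ts', ⟨h1, h2⟩, h⟩
      refine ⟨?_, by rw [hlab _ _ h, h2, msetM_succ]⟩
      have hlt : ∀ y ∈ forestLabels ts', y < n + 1 := fun y hy =>
        Nat.lt_succ_of_le (mem_msetM (h2 ▸ hy)).2
      rcases List.mem_cons.1 h with rfl | h
      · exact h1.star_cons (by omega) hlt
      · exact (good_insert ts' hlt).1 0 (by omega) h1 _ h
    · rintro ⟨h1, h2⟩
      have hcount : (forestLabels ts).count (n + 1) = k (n + 1) := by
        rw [h2, count_msetM_succ_self]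
      rcases (exists_mem_insert hk1 ts fun y hy => (mem_msetM (h2 ▸ hy)).2).1 0 (by omega) h1 with
        h | ⟨-, h⟩
      · omega
      · obtain ⟨ts', hg, hmem⟩ := h hcount
        refine ⟨ts', ⟨hg, ?_⟩, hmem⟩
        have := hlab _ _ hmem
        rw [h2, msetM_succ] at this
        exact (add_right_cancel this).symm

theorem lt_of_mem_rootForests {n : ℕ} {k : ℕ → ℕ} (hk : ∀ i, 1 ≤ i → i ≤ n → 1 ≤ k i)
    {ts : List LTree} (h : ts ∈ rootForests k n) : ∀ y ∈ forestLabels ts, y < n + 1 :=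
  fun _ hy => Nat.lt_succ_of_le (mem_msetM (((mem_rootForests hk).1 h).2 ▸ hy)).2

theorem nodup_rootForests {n : ℕ} {k : ℕ → ℕ} (hk : ∀ i, 1 ≤ i → i ≤ n → 1 ≤ k i) :
    (rootForests k n).Nodup := by
  induction n with
  | zero => simp [rootForests]
  | succ n ih =>
    have hk' : ∀ i, 1 ≤ i → i ≤ n → 1 ≤ k i := fun i h1 h2 => hk i h1 (by omega)
    have hnot : ∀ ts ∈ rootForests k n, n + 1 ∉ forestLabels ts := fun ts hts hn =>
      lt_irrefl _ (lt_of_mem_rootForests hk' hts _ hn)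
    have hprune : ∀ ts ∈ rootForests k n, ∀ ts' ∈ (star (n + 1) (k (n + 1) - 1) :: ts) ::
        evenInsert (star (n + 1) (k (n + 1) - 1)) ts, prune (n + 1) ts' = ts := by
      intro ts hts ts' h
      rcases List.mem_cons.1 h with rfl | h
      · rw [prune_star_cons, prune_eq_self (hnot ts hts)]
      · exact (prune_insert ts (hnot ts hts)).1 _ h
    rw [rootForests, List.nodup_flatMap]
    refine ⟨fun ts hts => List.nodup_cons.2
      ⟨star_cons_notMem_evenInsert (hnot ts hts), (nodup_insert ts (hnot ts hts)).1⟩, ?_⟩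
    refine (ih hk').imp_of_mem fun {a b} ha hb hab => ?_
    intro ts hta htb
    exact hab ((hprune a ha ts hta).symm.trans (hprune b hb ts htb))

theorem sum_eleafAux_insert {m c : ℕ} (ts : List LTree) :
    (∀ ts' ∈ (star m c :: ts) :: evenInsert (star m c) ts,
      (ts'.map (eleafAux · false)).sum ≤ (ts.map (eleafAux · false)).sum + c) ∧
    (∀ ts' ∈ oddInsert (star m c) ts,
      (ts'.map (eleafAux · true)).sum ≤ (ts.map (eleafAux · true)).sum + c) := by
  have hstar : (star m c).eleafAux false = c := by
    simp [star, eleafAux_node]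
  induction ts using forest_induction with
  | nil => simp [evenInsert, oddInsert, hstar]
  | cons y ss ts ihs iht =>
    constructor
    · intro ts' h
      simp only [evenInsert, List.mem_append, List.mem_map, List.mem_cons] at h
      rcases h with rfl | ⟨ss', h, rfl⟩ | ⟨ts', h, rfl⟩
      · simp only [List.map_cons, List.sum_cons, hstar]; omega
      · have := ihs.2 _ h
        simp only [List.map_cons, List.sum_cons, eleafAux_node, cond_false, Bool.not_false]
        omega
      · have := iht.1 ts' (List.mem_cons.2 h)
        simp only [List.map_cons, List.sum_cons]
        omega
    · intro ts' h
      simp only [oddInsert, List.mem_append, List.mem_map] at h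
      rcases h with ⟨ss', h, rfl⟩ | ⟨_, h, rfl⟩
      · have := ihs.1 _ h
        have hne : ss'.isEmpty = false := by
          rcases ss' with _ | _
          · rcases ss with _ | ⟨⟨z, us⟩, ss⟩ <;> simp [evenInsert] at h
          · rfl
        simp only [List.map_cons, List.sum_cons, eleafAux_node, cond_true, Bool.not_true, hne,
          Bool.false_eq_true, if_false]
        omega
      · have := iht.2 _ h
        simp only [List.map_cons, List.sum_cons]
        omega

theorem sum_eleafAux_rootForests {n : ℕ} {k : ℕ → ℕ} (hk : ∀ i, 1 ≤ i → i ≤ n → 1 ≤ k i)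
    {ts : List LTree} (h : ts ∈ rootForests k n) :
    (ts.map (eleafAux · false)).sum + n ≤ ∑ i ∈ Finset.Icc 1 n, k i := by
  induction n generalizing ts with
  | zero =>
    simp only [rootForests, List.mem_singleton] at h
    simp [h]
  | succ n ih =>
    rw [rootForests, List.mem_flatMap] at h
    obtain ⟨ts', h1, h2⟩ := h
    have h3 := ih (fun i h1 h2 => hk i h1 (by omega)) h1
    have h4 := (sum_eleafAux_insert ts').1 ts h2
    have h5 := hk (n + 1) (by omega) le_rfl
    rw [Finset.sum_Icc_succ_top (by omega)]
    omega

end LTree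

/-! ### The weight of a forest and its behaviour under insertion -/

namespace LTree

open MvPolynomial

/-- The weight of the letter `y` between `x` and `z`: the variables `X 0`, `X 1`, `X 2` mark
peaks, double ascents and double descents. -/
noncomputable def letterWeight (x y z : ℕ) : MvPolynomial (Fin 4) ℤ :=
  if x < y then (if y < z then X 1 else X 0) else (if y < z then 1 else X 2)

/-- The label of the first tree of a forest, with default value `a`. -/
def headLabel (a : ℕ) : List LTree → ℕ
  | [] => a
  | t :: _ => t.label

theorem headLabel_cons (a y : ℕ) (ss ts : List LTree) : headLabel a (node y ss :: ts) = y := rfl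

mutual

/-- The weight of the forest `ts` below an even vertex labeled `a`, where `x` is the label
preceding `ts` in the word of that vertex. -/
noncomputable def evenWeight : List LTree → ℕ → ℕ → MvPolynomial (Fin 4) ℤ
  | [], _, _ => 1
  | node y ss :: ts, a, x => letterWeight x y (headLabel a ts) * oddWeight ss * evenWeight ts a y

/-- The weight of the forest `ss` below an odd vertex; `X 3` marks the leaves at even level. -/
noncomputable def oddWeight : List LTree → MvPolynomial (Fin 4) ℤ
  | [] => 1
  | node s ts :: ss => (if ts.isEmpty then X 3 else evenWeight ts s s) * oddWeight ss

end

/-- The derivation recording the effect of inserting a new maximal vertex. -/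
noncomputable def treeDeriv : Derivation ℤ (MvPolynomial (Fin 4) ℤ) (MvPolynomial (Fin 4) ℤ) :=
  mkDerivation ℤ ![X 0 * (X 1 + X 2), X 0, X 0, X 0]

theorem treeDeriv_letterWeight {x y z m : ℕ} (hym : y < m) :
    treeDeriv (letterWeight x y z) = (if x < y then X 0 * letterWeight m y z else 0) +
      (if y < z then 0 else X 0 * letterWeight x y m) := by
  unfold letterWeight treeDeriv
  split_ifs <;> (try omega) <;> simp [mkDerivation_X]
  ring

theorem evenWeight_congr {ts : List LTree} {a x x' : ℕ} (h : ¬ x < headLabel a ts)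
    (h' : ¬ x' < headLabel a ts) : evenWeight ts a x = evenWeight ts a x' := by
  rcases ts with _ | ⟨⟨y, ss⟩, ts⟩
  · simp [evenWeight]
  · rw [headLabel_cons] at h h'
    rw [evenWeight, evenWeight, letterWeight, letterWeight, if_neg h, if_neg h']

theorem oddWeight_replicate (m c : ℕ) : oddWeight (List.replicate c (node m [])) = X 3 ^ c := by
  induction c with
  | zero => simp [oddWeight]
  | succ c ih =>
    rw [List.replicate_succ, oddWeight, ih, pow_succ]
    simp [mul_comm]

theorem headLabel_lt {ts : List LTree} {a m : ℕ} (ha : a < m)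
    (hm : ∀ y ∈ forestLabels ts, y < m) : headLabel a ts < m := by
  rcases ts with _ | ⟨⟨y, ss⟩, ts⟩
  · exact ha
  · exact hm y (by simp)

theorem evenWeight_star_cons {ts : List LTree} {a x m c : ℕ} (ha : a < m) (hx : x < m)
    (hm : ∀ y ∈ forestLabels ts, y < m) :
    evenWeight (star m c :: ts) a x = X 0 * X 3 ^ c * evenWeight ts a m := by
  rw [star, evenWeight, letterWeight, if_pos hx, if_neg (headLabel_lt ha hm).not_gt,
    oddWeight_replicate]

theorem headLabel_of_mem_evenInsert {N : LTree} {ts ts' : List LTree} {a : ℕ}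
    (h : ts' ∈ evenInsert N ts) : headLabel a ts' = headLabel a ts := by
  rcases ts with _ | ⟨⟨y, ss⟩, ts⟩
  · simp [evenInsert] at h
  · simp only [evenInsert, List.mem_append, List.mem_map] at h
    rcases h with ⟨_, _, rfl⟩ | ⟨_, _, rfl⟩ <;> rfl

theorem sum_weight_insert {k : ℕ → ℕ} {m c : ℕ} (ts : List LTree)
    (hm : ∀ y ∈ forestLabels ts, y < m) :
    (∀ a x, EvenGood k ts a → a ≤ x → x < m →
      ((evenInsert (star m c) ts).map (evenWeight · a x)).sum =
        X 3 ^ c * (treeDeriv (evenWeight ts a x) -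
          if x < headLabel a ts then X 0 * evenWeight ts a m else 0)) ∧
    (∀ a, OddGood k ts a →
      ((oddInsert (star m c) ts).map oddWeight).sum = X 3 ^ c * treeDeriv (oddWeight ts)) := by
  induction ts using forest_induction with
  | nil =>
    constructor
    · intro a x _ hax _
      simp [evenInsert, evenWeight, headLabel, hax.not_gt]
    · simp [oddInsert, oddWeight]
  | cons y ss ts ihs iht =>
    simp only [forestLabels_cons, Multiset.mem_add, Multiset.mem_cons] at hm
    have hy : y < m := hm y (by simp)
    have hss : ∀ z ∈ forestLabels ss, z < m := fun z hz => hm z (by simp [hz])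
    have hts : ∀ z ∈ forestLabels ts, z < m := fun z hz => hm z (by simp [hz])
    have ihs := ihs hss
    have iht := iht hts
    constructor
    · intro a x hg hax hxm
      obtain ⟨h1, h2, h3, h4, h5⟩ := evenGood_cons.1 hg
      have ham : a < m := h1.trans hy
      have hh := headLabel_lt ham hts
      have e1 : ((oddInsert (star m c) ss).map fun ss' => evenWeight (node y ss' :: ts) a x).sum =
          letterWeight x y (headLabel a ts) * (X 3 ^ c * treeDeriv (oddWeight ss)) *
            evenWeight ts a y := by
        rw [← ihs.2 y h4, ← List.sum_map_mul_left, ← List.sum_map_mul_right]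
        simp only [evenWeight]
      have e2 : ((evenInsert (star m c) ts).map fun ts' => evenWeight (node y ss :: ts') a x).sum =
          letterWeight x y (headLabel a ts) * oddWeight ss *
            (X 3 ^ c * (treeDeriv (evenWeight ts a y) -
              if y < headLabel a ts then X 0 * evenWeight ts a m else 0)) := by
        rw [← iht.1 a y h5 h1.le hy, ← List.sum_map_mul_left]
        congr 1
        refine List.map_congr_left fun ts' h => ?_
        rw [evenWeight, headLabel_of_mem_evenInsert h]
      have e3 : evenWeight (node y ss :: star m c :: ts) a x =
          letterWeight x y m * oddWeight ss * (X 0 * X 3 ^ c * evenWeight ts a m) := by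
        rw [evenWeight, evenWeight_star_cons ham hy hts]
        rfl
      rw [evenInsert, List.map_append, List.sum_append, List.map_map, List.map_map, List.map_cons,
        List.sum_cons]
      simp only [Function.comp_def]
      rw [e1, e2, e3]
      simp only [evenWeight, Derivation.leibniz, smul_eq_mul, headLabel_cons,
        treeDeriv_letterWeight hy]
      by_cases hlt : y < headLabel a ts
      · have : letterWeight x y m = letterWeight x y (headLabel a ts) := by
          simp [letterWeight, hlt, hy]
        rw [this]
        simp only [hlt, if_true]
        split_ifs <;> ring
      · rw [evenWeight_congr (x := m) (x' := y) hh.not_gt hlt]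
        simp only [hlt, if_false]
        split_ifs <;> ring
    · intro a hg
      obtain ⟨rfl, h2, h3⟩ := oddGood_cons.1 hg
      have hD : (((star m c :: ss) :: evenInsert (star m c) ss).map
          fun ss' => if ss'.isEmpty then X 3 else evenWeight ss' y y).sum =
          X 3 ^ c * treeDeriv (if ss.isEmpty then X 3 else evenWeight ss y y) := by
        rcases ss with _ | ⟨⟨z, us⟩, ss⟩
        · simp only [evenInsert, List.map_cons, List.map_nil, List.sum_singleton,
            List.isEmpty_cons, List.isEmpty_nil, if_true]
          rw [if_neg (by simp), evenWeight_star_cons hy hy hss, evenWeight, treeDeriv,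
            mkDerivation_X]
          simp [mul_comm]
        · have hyz : y < z := (evenGood_cons.1 h2).1
          have hcongr : (evenInsert (star m c) (node z us :: ss)).map
              (fun ss' => if ss'.isEmpty then X 3 else evenWeight ss' y y) =
              (evenInsert (star m c) (node z us :: ss)).map (evenWeight · y y) := by
            refine List.map_congr_left fun l hl => ?_
            rw [if_neg]
            rcases l with _ | _
            · simp [evenInsert] at hl
            · simp
          rw [List.map_cons, List.sum_cons, hcongr, ihs.1 y y h2 le_rfl hy, headLabel_cons,
            if_pos hyz, if_neg (by simp), if_neg (by simp), evenWeight_star_cons hy hy hss]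
          ring
      have e1 : (((star m c :: ss) :: evenInsert (star m c) ss).map
          fun ss' => oddWeight (node y ss' :: ts)).sum =
          X 3 ^ c * treeDeriv (if ss.isEmpty then X 3 else evenWeight ss y y) * oddWeight ts := by
        rw [← hD, ← List.sum_map_mul_right]
        simp only [oddWeight]
      have e2 : ((oddInsert (star m c) ts).map fun ts' => oddWeight (node y ss :: ts')).sum =
          (if ss.isEmpty then X 3 else evenWeight ss y y) *
            (X 3 ^ c * treeDeriv (oddWeight ts)) := by
        rw [← iht.2 y h3, ← List.sum_map_mul_left]
        simp only [oddWeight]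
      rw [oddInsert, List.map_append, List.sum_append, List.map_map, List.map_map]
      simp only [Function.comp_def]
      rw [e1, e2, oddWeight, Derivation.leibniz, smul_eq_mul, smul_eq_mul]
      ring

/-- The total weight of the weakly increasing trees for `{1^{k 1}, …, n^{k n}}`. -/
noncomputable def treePoly (k : ℕ → ℕ) (n : ℕ) : MvPolynomial (Fin 4) ℤ :=
  ((rootForests k n).map fun ts => oddWeight [node 0 ts]).sum

theorem treePoly_zero (k : ℕ → ℕ) : treePoly k 0 = X 3 := by
  simp [treePoly, rootForests, oddWeight]

theorem treePoly_succ {n : ℕ} {k : ℕ → ℕ} (hk : ∀ i, 1 ≤ i → i ≤ n → 1 ≤ k i) :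
    treePoly k (n + 1) = X 3 ^ (k (n + 1) - 1) * treeDeriv (treePoly k n) := by
  rw [treePoly, treePoly, rootForests, List.sum_map_flatMap, map_list_sum,
    ← List.sum_map_mul_left, List.map_map]
  congr 1
  refine List.map_congr_left fun ts hts => ?_
  have hlt := lt_of_mem_rootForests hk hts
  have h := (sum_weight_insert (k := k) (m := n + 1) (c := k (n + 1) - 1) [node 0 ts]
    (by simpa using hlt)).2 0
    (oddGood_cons.2 ⟨rfl, ((mem_rootForests hk).1 hts).1, by simp [OddGood]⟩)
  rw [oddInsert, oddInsert, List.map_nil, List.append_nil, List.map_map] at h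
  exact h

/-- The common source of both recursions: a polynomial in `u`, `v`, `z`. -/
noncomputable def gammaDeriv : Derivation ℤ (MvPolynomial (Fin 3) ℤ) (MvPolynomial (Fin 3) ℤ) :=
  mkDerivation ℤ ![X 0 * X 1, X 0 + X 0, X 0]

/-- The polynomial `∑ γ_{i,j} u^j v^{K+1-i-2j} z^i`, defined recursively. -/
noncomputable def gammaPoly (k : ℕ → ℕ) : ℕ → MvPolynomial (Fin 3) ℤ
  | 0 => X 2
  | n + 1 => X 2 ^ (k (n + 1) - 1) * gammaDeriv (gammaPoly k n)

theorem derivation_aeval_eq {σ τ : Type*}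
    (D : Derivation ℤ (MvPolynomial σ ℤ) (MvPolynomial σ ℤ))
    (D' : Derivation ℤ (MvPolynomial τ ℤ) (MvPolynomial τ ℤ)) (f : σ → MvPolynomial τ ℤ)
    (h : ∀ i, D' (f i) = aeval f (D (X i))) (p : MvPolynomial σ ℤ) :
    D' (aeval f p) = aeval f (D p) := by
  induction p using MvPolynomial.induction_on with
  | C a => simp
  | add p q hp hq => rw [map_add, map_add, hp, hq, map_add, map_add]
  | mul_X p i hp =>
    rw [map_mul, aeval_X, Derivation.leibniz, Derivation.leibniz, hp, h]
    simp only [smul_eq_mul, map_add, map_mul, aeval_X]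

theorem QPoly_eq_aeval_gammaPoly {n : ℕ} {k : ℕ → ℕ} (hk : ∀ i, 1 ≤ i → i ≤ n → 1 ≤ k i) :
    QPoly (msetM n k) =
      aeval (![X 0 * X 1, X 0 + X 1, X 2] : Fin 3 → MvPolynomial (Fin 3) ℤ) (gammaPoly k n) := by
  induction n with
  | zero => simp [QPoly_msetM_zero, gammaPoly]
  | succ n ih =>
    rw [QPoly_msetM_succ hk, ih fun i h1 h2 => hk i h1 (by omega), gammaPoly,
      derivation_aeval_eq gammaDeriv]
    · simp
    · intro i
      fin_cases i <;> simp [gammaDeriv, wordDeriv, mkDerivation_X, Derivation.leibniz]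
      ring

theorem treePoly_eq_aeval_gammaPoly {n : ℕ} {k : ℕ → ℕ} (hk : ∀ i, 1 ≤ i → i ≤ n → 1 ≤ k i) :
    treePoly k n =
      aeval (![X 0, X 1 + X 2, X 3] : Fin 3 → MvPolynomial (Fin 4) ℤ) (gammaPoly k n) := by
  induction n with
  | zero => simp [treePoly_zero, gammaPoly]
  | succ n ih =>
    have hk' : ∀ i, 1 ≤ i → i ≤ n → 1 ≤ k i := fun i h1 h2 => hk i h1 (by omega)
    rw [treePoly_succ hk', ih hk', gammaPoly, derivation_aeval_eq gammaDeriv]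
    · simp
    · intro i
      fin_cases i <;> simp [gammaDeriv, treeDeriv, mkDerivation_X]

/-- The specialisation of the forest weight that kills double descents. -/
noncomputable def gammaSpec : MvPolynomial (Fin 4) ℤ →ₐ[ℤ] MvPolynomial (Fin 3) ℤ :=
  aeval ![X 0 * X 1, X 0 + X 1, 0, X 2]

theorem QPoly_eq_sum_gammaSpec {n : ℕ} {k : ℕ → ℕ} (hk : ∀ i, 1 ≤ i → i ≤ n → 1 ≤ k i) :
    QPoly (msetM n k) =
      ((rootForests k n).map fun ts => gammaSpec (oddWeight [node 0 ts])).sum := by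
  have h : gammaSpec (treePoly k n) = QPoly (msetM n k) := by
    rw [QPoly_eq_aeval_gammaPoly hk, treePoly_eq_aeval_gammaPoly hk, ← AlgHom.comp_apply]
    congr 1
    ext i
    fin_cases i <;> simp [gammaSpec]
  rw [← h, treePoly, map_list_sum, List.map_map]
  rfl

end LTree

/-! ### Cyclic statistics and the specialised weight -/

/-- The indicator of a descent from `x` to `y`. -/
def descent (x y : ℕ) : ℕ := if y < x then 1 else 0

theorem descent_of_lt {x y : ℕ} (h : y < x) : descent x y = 1 := if_pos h

theorem descent_of_le {x y : ℕ} (h : x ≤ y) : descent x y = 0 := if_neg h.not_gt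

/-- The number of descents of the word `x v₁ … v_l a`, where `vs = v₁ … v_l`. -/
def linDes (a : ℕ) : ℕ → List ℕ → ℕ
  | x, [] => descent x a
  | x, y :: vs => descent x y + linDes a y vs

/-- The number of double descents of the word `x v₁ … v_l a` at the letters of `vs = v₁ … v_l`. -/
def linDdes (a : ℕ) : ℕ → List ℕ → ℕ
  | _, [] => 0
  | x, y :: vs => descent x y * descent y (vs.headD a) + linDdes a y vs

theorem countP_zip_append_singleton (a x : ℕ) (vs : List ℕ) :
    ((x :: vs).zip (vs ++ [a])).countP (fun p => decide (p.2 < p.1)) = linDes a x vs := by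
  induction vs generalizing x with
  | nil => simp [linDes, descent, List.countP_cons]
  | cons y vs ih =>
    rw [List.cons_append, List.zip_cons_cons, List.countP_cons, ih, linDes, add_comm, descent]
    simp

theorem cdesW_cons (a : ℕ) (vs : List ℕ) : cdesW (a :: vs) = linDes a a vs := by
  rw [cdesW, List.rotate_cons_succ, List.rotate_zero, countP_zip_append_singleton]

theorem cdesW_cons_of_forall_eq {a : ℕ} {vs : List ℕ} (h : ∀ v ∈ vs, v = a) :
    cdesW (a :: vs) = 0 := by
  rw [cdesW_cons]
  induction vs with
  | nil => simp [linDes, descent]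
  | cons y vs ih =>
    obtain rfl := h y (by simp)
    simp [linDes, descent, ih fun v hv => h v (by simp [hv])]

theorem countP_zip_zip_append_singleton (a x l : ℕ) (vs us : List ℕ) (hv : us ++ [l] = x :: vs) :
    (us.zip (vs.zip (vs.tail ++ [a]))).countP (fun p => decide (p.2.1 < p.1 ∧ p.2.2 < p.2.1)) =
      linDdes a x vs := by
  induction vs generalizing x us with
  | nil => simp [linDdes]
  | cons y vs ih =>
    rcases us with _ | ⟨u, us⟩
    · simp at hv
    rw [List.cons_append] at hv
    obtain ⟨rfl, hv'⟩ := List.cons.inj hv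
    have h := ih y us hv'
    rw [List.tail_cons, linDdes, ← h]
    rcases vs with _ | ⟨w, vs⟩
    · simp [List.countP_cons, add_comm, descent, ← ite_and, and_comm]
    · simp [List.countP_cons, add_comm, descent, ← ite_and, and_comm]

theorem dcdesW_cons {a : ℕ} {vs : List ℕ} (h : ∀ v ∈ vs, a < v) :
    dcdesW (a :: vs) = linDdes a a vs := by
  rcases vs with _ | ⟨y, vs⟩
  · simp [dcdesW, cycTriples, linDdes]
  · obtain ⟨us, l, hl⟩ : ∃ us l, y :: vs = us ++ [l] :=
      ⟨_, _, (List.dropLast_append_getLast (List.cons_ne_nil y vs)).symm⟩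
    have hrot : (a :: y :: vs).rotate ((a :: y :: vs).length - 1) = l :: a :: us := by
      have : (a :: y :: vs).length - 1 = (a :: us).length := by
        have := congrArg List.length hl
        simp at this ⊢
        omega
      rw [this, hl, ← List.cons_append, List.rotate_append_length_eq]
      rfl
    have hay : a < y := h y (by simp)
    have hc := countP_zip_zip_append_singleton a a l (y :: vs) (a :: us) (by simp [hl])
    rw [dcdesW, cycTriples, hrot, List.rotate_cons_succ, List.rotate_zero, ← hc,
      List.cons_append, List.zip_cons_cons, List.zip_cons_cons, List.countP_cons]
    simp [hay.not_gt]

theorem one_le_linDes {a x : ℕ} {vs : List ℕ} (hx : a < x) (h : ∀ v ∈ vs, a < v) :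
    1 ≤ linDes a x vs := by
  induction vs generalizing x with
  | nil => exact (descent_of_lt hx).ge
  | cons y vs ih =>
    exact (ih (h y (by simp)) fun v hv => h v (by simp [hv])).trans (Nat.le_add_left _ _)

namespace LTree

open MvPolynomial

theorem headLabel_eq_headD (a : ℕ) (ts : List LTree) :
    headLabel a ts = (ts.map label).headD a := by
  rcases ts with _ | ⟨t, ts⟩ <;> rfl

theorem EvenGood.lt_label {k : ℕ → ℕ} {a : ℕ} {ts : List LTree} (h : EvenGood k ts a) :
    ∀ v ∈ ts.map label, a < v := by
  induction ts with
  | nil => simp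
  | cons t ts ih =>
    obtain ⟨y, ss⟩ := t
    obtain ⟨h1, -, -, -, h5⟩ := evenGood_cons.1 h
    simp only [List.map_cons, List.mem_cons, forall_eq_or_imp]
    exact ⟨h1, ih h5⟩

theorem label_mem_forestLabels {t : LTree} {ts : List LTree} (h : t ∈ ts) :
    t.label ∈ forestLabels ts := by
  induction ts with
  | nil => simp at h
  | cons s ts ih =>
    obtain ⟨y, ss⟩ := s
    rcases List.mem_cons.1 h with rfl | h
    · simp [label]
    · simp [ih h]

theorem ne_headLabel {a y : ℕ} {ts : List LTree} (hay : a < y) (hy : y ∉ forestLabels ts) :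
    y ≠ headLabel a ts := by
  rcases ts with _ | ⟨t, ts⟩
  · exact hay.ne'
  · rintro rfl
    exact hy (label_mem_forestLabels (by simp))

theorem gammaSpec_weight {k : ℕ → ℕ} (ts : List LTree) :
    (∀ a x, EvenGood k ts a → a ≤ x → x ≠ headLabel a ts → ∃ d s : ℕ,
      linDes a x (ts.map label) + (ts.map cdes).sum =
        d + descent x (headLabel a ts) ∧
      gammaSpec (evenWeight ts a x) =
        (if linDdes a x (ts.map label) + (ts.map (evenSum dcdesW · false)).sum = 0 then
          (X 0 * X 1) ^ d * (X 0 + X 1) ^ s * X 2 ^ (ts.map (eleafAux · false)).sum else 0) ∧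
      (linDdes a x (ts.map label) + (ts.map (evenSum dcdesW · false)).sum = 0 →
        2 * d + s + (ts.map (eleafAux · false)).sum + descent x (headLabel a ts) =
          Multiset.card (forestLabels ts) + 1)) ∧
    (∀ a, OddGood k ts a → ∃ s : ℕ,
      gammaSpec (oddWeight ts) =
        (if (ts.map (evenSum dcdesW · true)).sum = 0 then
          (X 0 * X 1) ^ (ts.map cdes).sum * (X 0 + X 1) ^ s *
            X 2 ^ (ts.map (eleafAux · true)).sum else 0) ∧
      ((ts.map (evenSum dcdesW · true)).sum = 0 →
        2 * (ts.map cdes).sum + s + (ts.map (eleafAux · true)).sum =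
          Multiset.card (forestLabels ts))) := by
  induction ts using forest_induction with
  | nil =>
    constructor
    · intro a x _ hax hx
      have : a < x := lt_of_le_of_ne hax (Ne.symm hx)
      exact ⟨0, 0, by simp [linDes, headLabel], by simp [evenWeight, linDdes],
        by simp [headLabel, descent_of_lt this]⟩
    · intro a _
      exact ⟨0, by simp [oddWeight], by simp⟩
  | cons y ss ts ihs iht =>
    constructor
    · intro a x hg hax hx
      obtain ⟨h1, h2, h3, h4, h5⟩ := evenGood_cons.1 hg
      rw [headLabel_cons] at hx
      obtain ⟨s₁, hw₁, hc₁⟩ := ihs.2 y h4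
      obtain ⟨d, s₂, hd, hw₂, hc₂⟩ := iht.1 a y h5 h1.le (ne_headLabel h1 h2)
      have hne := ne_headLabel h1 h2
      have hcd : (node y ss).cdes = (ss.map cdes).sum := by
        rw [cdes_node, cdesW_cons_of_forall_eq, zero_add]
        intro v hv
        obtain ⟨s, hs, rfl⟩ := List.mem_map.1 hv
        exact ((incr_of_good ss).2 y h4).1 s hs
      have hel : (node y ss).eleafAux false = (ss.map (eleafAux · true)).sum := by
        rw [eleafAux_node]; simp
      have hdd : (node y ss).evenSum dcdesW false = (ss.map (evenSum dcdesW · true)).sum := by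
        rw [evenSum_node]; simp
      simp only [List.map_cons, List.sum_cons, hcd, hel, hdd, headLabel_cons, label, linDes,
        linDdes, forestLabels_cons, Multiset.card_add, Multiset.card_cons, evenWeight, map_mul,
        ← headLabel_eq_headD, hw₁, hw₂]
      generalize headLabel a ts = nxt at *
      generalize (ss.map (evenSum dcdesW · true)).sum = A₁ at *
      generalize linDdes a y (ts.map label) = L at *
      generalize (ts.map (evenSum dcdesW · false)).sum = A₂ at *
      generalize (ss.map cdes).sum = c₁ at *
      generalize (ts.map cdes).sum = c₂ at *
      generalize (ss.map (eleafAux · true)).sum = e₁ at *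
      generalize (ts.map (eleafAux · false)).sum = e₂ at *
      by_cases hA₁ : A₁ = 0
      · by_cases hA₂ : L + A₂ = 0
        · replace hc₁ := hc₁ hA₁
          replace hc₂ := hc₂ hA₂
          rw [if_pos hA₁, if_pos hA₂]
          obtain ⟨rfl, rfl⟩ : L = 0 ∧ A₂ = 0 := by omega
          subst hA₁
          rcases lt_or_gt_of_ne hx with hx | hx <;> rcases lt_or_gt_of_ne hne with hn | hn
          · refine ⟨d + c₁, s₁ + s₂ + 1, ?_, ?_, ?_⟩
            · simp only [descent_of_le hx.le, descent_of_le hn.le] at hd ⊢; omega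
            · simp [descent_of_le hx.le, hx, hn, letterWeight, gammaSpec]; ring
            · simp only [descent_of_le hx.le, descent_of_le hn.le] at hc₂ ⊢
              intro _
              omega
          · refine ⟨d + c₁ + 1, s₁ + s₂, ?_, ?_, ?_⟩
            · simp only [descent_of_le hx.le, descent_of_lt hn] at hd ⊢; omega
            · simp [descent_of_le hx.le, hx, hn.not_gt, letterWeight, gammaSpec]; ring
            · simp only [descent_of_le hx.le, descent_of_lt hn] at hc₂ ⊢
              intro _
              omega
          · refine ⟨d + c₁, s₁ + s₂, ?_, ?_, ?_⟩
            · simp only [descent_of_lt hx, descent_of_le hn.le] at hd ⊢; omega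
            · simp [descent_of_lt hx, descent_of_le hn.le, hx.not_gt, hn, letterWeight, gammaSpec]; ring
            · simp only [descent_of_lt hx, descent_of_le hn.le] at hc₂ ⊢
              intro _
              omega
          · refine ⟨d + c₁ + 1, 0, ?_, ?_, ?_⟩
            · simp only [descent_of_lt hx, descent_of_lt hn] at hd ⊢; omega
            · simp [descent_of_lt hx, descent_of_lt hn, hx.not_gt, hn.not_gt, letterWeight, gammaSpec]
            · simp [descent_of_lt hx, descent_of_lt hn]
        · refine ⟨d + c₁ + descent y nxt, 0, by omega, ?_, fun h => by omega⟩
          rw [if_neg hA₂, mul_zero]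
          exact (if_neg (by omega)).symm
      · refine ⟨d + c₁ + descent y nxt, 0, by omega, ?_, fun h => by omega⟩
        rw [if_neg hA₁, mul_zero, zero_mul]
        exact (if_neg (by omega)).symm
    · intro a hg
      obtain ⟨rfl, h2, h3⟩ := oddGood_cons.1 hg
      obtain ⟨s₂, hw₂, hc₂⟩ := iht.2 y h3
      have key : ∃ s : ℕ, gammaSpec (if ss.isEmpty then X 3 else evenWeight ss y y) =
          (if (node y ss).evenSum dcdesW true = 0 then
            (X 0 * X 1) ^ (node y ss).cdes * (X 0 + X 1) ^ s *
              X 2 ^ (node y ss).eleafAux true else 0) ∧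
          ((node y ss).evenSum dcdesW true = 0 →
            2 * (node y ss).cdes + s + (node y ss).eleafAux true =
              Multiset.card (forestLabels ss) + 1) := by
        rw [cdes_node, eleafAux_node, evenSum_node, cond_true, cond_true, cdesW_cons,
          dcdesW_cons h2.lt_label]
        rcases ss with _ | ⟨⟨z, us⟩, ss⟩
        · exact ⟨0, by simp [gammaSpec, linDdes, linDes, descent], by simp [linDes, descent]⟩
        · have hyz : y < z := (evenGood_cons.1 h2).1
          obtain ⟨d, s, hd, hw, hc⟩ := ihs.1 y y h2 le_rfl hyz.ne
          rw [headLabel_cons, descent_of_le hyz.le, add_zero] at hd hc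
          refine ⟨s, ?_, ?_⟩
          · rw [hd, if_neg (by simp), hw]
            simp
          · intro h
            rw [hd, ← hc h]
            simp
      obtain ⟨s₁, hw₁, hc₁⟩ := key
      simp only [List.map_cons, List.sum_cons, oddWeight, map_mul, hw₁, hw₂, forestLabels_cons,
        Multiset.card_add, Multiset.card_cons]
      refine ⟨s₁ + s₂, ?_, ?_⟩
      · split_ifs <;> first | omega | ring
      · intro h
        have := hc₁ (by omega)
        have := hc₂ (by omega)
        omega

theorem gammaSpec_oddWeight_root {n : ℕ} {k : ℕ → ℕ} {ts : List LTree}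
    (h : EvenGood k ts 0 ∧ forestLabels ts = msetM n k) {K : ℕ}
    (hK : K = ∑ i ∈ Finset.Icc 1 n, k i) :
    gammaSpec (oddWeight [node 0 ts]) =
      (if (node 0 ts).dcdes = 0 then
        X 2 ^ (node 0 ts).eleaf * ((X 0 * X 1) ^ (node 0 ts).cdes *
          (X 0 + X 1) ^ (K + 1 - (node 0 ts).eleaf - 2 * (node 0 ts).cdes)) else 0) ∧
    ((node 0 ts).dcdes = 0 → 2 * (node 0 ts).cdes + (node 0 ts).eleaf ≤ K + 1) := by
  obtain ⟨s, hw, hc⟩ := (gammaSpec_weight (k := k) [node 0 ts]).2 0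
    (oddGood_cons.2 ⟨rfl, h.1, by simp [OddGood]⟩)
  simp only [List.map_cons, List.map_nil, List.sum_cons, List.sum_nil, add_zero,
    forestLabels_cons, forestLabels_nil, Multiset.card_cons, h.2, card_msetM, ← hK] at hw hc
  change gammaSpec _ = if (node 0 ts).dcdes = 0 then
    _ * _ * X 2 ^ (node 0 ts).eleaf else 0 at hw
  change (node 0 ts).dcdes = 0 → _ + _ + (node 0 ts).eleaf = _ at hc
  refine ⟨?_, fun h0 => by have := hc h0; omega⟩
  rw [hw]
  split_ifs with h0
  · have hs : s = K + 1 - (node 0 ts).eleaf - 2 * (node 0 ts).cdes := by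
      have := hc h0
      omega
    rw [hs]
    ring
  · rfl

theorem one_le_cdes_root {k : ℕ → ℕ} {ts : List LTree} (h : EvenGood k ts 0) (hts : ts ≠ []) :
    1 ≤ (node 0 ts).cdes := by
  rcases ts with _ | ⟨⟨y, ss⟩, ts⟩
  · exact absurd rfl hts
  · obtain ⟨h1, -, -, -, h5⟩ := evenGood_cons.1 h
    rw [cdes_node, cdesW_cons, List.map_cons, linDes]
    have := one_le_linDes (a := 0) (x := y) h1 h5.lt_label
    simp only [label]
    omega

theorem setOf_memIT_and {n : ℕ} {k : ℕ → ℕ} (hk : ∀ i, 1 ≤ i → i ≤ n → 1 ≤ k i)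
    (P : LTree → Prop) :
    {T : LTree | memIT n k T ∧ P T} =
      Set.image (node 0) ((rootForests k n).toFinset.filter fun ts => P (node 0 ts) :
        Finset (List LTree)) := by
  ext ⟨a, ts⟩
  simp only [Set.mem_ofPred_eq, Set.mem_image, Finset.coe_filter, List.mem_toFinset,
    mem_rootForests hk, ← memIT_node_zero, node.injEq]
  constructor
  · rintro ⟨h, hP⟩
    obtain rfl : a = 0 := h.1.1
    exact ⟨ts, ⟨h, hP⟩, rfl, rfl⟩
  · rintro ⟨_, h, rfl, rfl⟩
    exact h

end LTree

open MvPolynomial in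
/-- **Theorem 3.4 (Yan–Huang–Yang).**  For `M = {1^{k 1}, …, n^{k n}}` with every `k i ≥ 1`
and `K = k 1 + ⋯ + k n`,
`Q_M(x,y,z) = ∑_{i=0}^{K-n} z^i ∑_{j=1}^{⌊(K+1-i)/2⌋} γ_{i,j} (xy)^j (x+y)^{K+1-i-2j}`,
where `γ_{i,j} = #{T ∈ ℐ𝒯_M : cdes T = j, eleaf T = i, dcdes T = 0}`; in particular
`Q_M(x,y,z)` is partial γ-positive.
Here `x = X 0`, `y = X 1`, `z = X 2` in `ℤ[x,y,z] = MvPolynomial (Fin 3) ℤ`. -/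
theorem stirling_poly_gamma_expansion
    (n : ℕ) (hn : 1 ≤ n) (k : ℕ → ℕ) (hk : ∀ i, 1 ≤ i → i ≤ n → 1 ≤ k i)
    (K : ℕ) (hK : K = ∑ i ∈ Finset.Icc 1 n, k i) :
    QPoly (msetM n k)
      = ∑ i ∈ Finset.range (K - n + 1), (X 2 : MvPolynomial (Fin 3) ℤ) ^ i *
          ∑ j ∈ Finset.Icc 1 ((K + 1 - i) / 2),
            ({T : LTree | memIT n k T ∧ T.cdes = j ∧ T.eleaf = i ∧ T.dcdes = 0}.ncard :
                MvPolynomial (Fin 3) ℤ)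
              * (X 0 * X 1) ^ j * (X 0 + X 1) ^ (K + 1 - i - 2 * j) := by
  set S := (LTree.rootForests k n).toFinset with hS
  set S₀ := S.filter fun ts => (LTree.node 0 ts).dcdes = 0 with hS₀
  have hmem : ∀ ts ∈ S, ts ∈ LTree.rootForests k n := fun ts h => List.mem_toFinset.1 h
  have hcard : ∀ i j : ℕ,
      {T : LTree | memIT n k T ∧ T.cdes = j ∧ T.eleaf = i ∧ T.dcdes = 0}.ncard =
        (S₀.filter fun ts => (⟨(LTree.node 0 ts).eleaf, (LTree.node 0 ts).cdes⟩ : Σ _ : ℕ, ℕ) =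
          ⟨i, j⟩).card := by
    intro i j
    rw [LTree.setOf_memIT_and hk, Set.ncard_image_of_injective _ fun a b h => by simpa using h,
      Set.ncard_coe_finset]
    congr 1
    ext ts
    simp only [hS₀, Finset.mem_filter, Sigma.mk.injEq, heq_eq_eq]
    tauto
  have hmaps : ∀ ts ∈ S₀,
      (⟨(LTree.node 0 ts).eleaf, (LTree.node 0 ts).cdes⟩ : Σ _ : ℕ, ℕ) ∈
        (Finset.range (K - n + 1)).sigma fun i => Finset.Icc 1 ((K + 1 - i) / 2) := by
    intro ts hts
    obtain ⟨hts, h0⟩ := Finset.mem_filter.1 hts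
    have hg := (LTree.mem_rootForests hk).1 (hmem ts hts)
    have hne : ts ≠ [] := by
      rintro rfl
      have := congrArg Multiset.card hg.2
      rw [card_msetM] at this
      have h1 := Finset.single_le_sum (f := k) (fun _ _ => Nat.zero_le _)
        (Finset.mem_Icc.2 ⟨le_rfl, hn⟩)
      have h2 := hk 1 le_rfl hn
      simp only [LTree.forestLabels_nil, Multiset.card_zero] at this
      omega
    have hle := LTree.sum_eleafAux_rootForests hk (hmem ts hts)
    have hel : (LTree.node 0 ts).eleaf = (ts.map (LTree.eleafAux · false)).sum := by
      rw [LTree.eleaf, LTree.eleafAux_node]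
      simp [hne]
    have h1 := LTree.one_le_cdes_root hg.1 hne
    have h2 := (LTree.gammaSpec_oddWeight_root hg hK).2 h0
    simp only [Finset.mem_sigma, Finset.mem_range, Finset.mem_Icc]
    omega
  rw [LTree.QPoly_eq_sum_gammaSpec hk, ← List.sum_toFinset _ (LTree.nodup_rootForests hk),
    Finset.sum_congr rfl fun ts hts =>
      (LTree.gammaSpec_oddWeight_root ((LTree.mem_rootForests hk).1 (hmem ts hts)) hK).1,
    ← Finset.sum_filter, ← Finset.sum_fiberwise_of_maps_to hmaps, Finset.sum_sigma]
  refine Finset.sum_congr rfl fun i _ => ?_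
  rw [Finset.mul_sum]
  refine Finset.sum_congr rfl fun j _ => ?_
  rw [hcard, Finset.sum_congr rfl (g := fun _ => X 2 ^ i * ((X 0 * X 1) ^ j *
    (X 0 + X 1) ^ (K + 1 - i - 2 * j))), Finset.sum_const, nsmul_eq_mul]
  · ring
  · intro ts hts
    obtain ⟨h1, h2⟩ := Sigma.mk.inj (Finset.mem_filter.1 hts).2
    rw [h1, eq_of_heq h2]
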